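/- arXiv:1901.01781 — 2 statements merged into one kernel-verified Lean document; each statement's English description precedes it below -/
import Mathlib

section
/- Let φ ∈ L¹((a,b)) for a bounded open interval (a,b). Then φ has a representative of bounded variation on (a,b) if and only if its subgraph SG_φ := {(s,t) ∈ (a,b) × ℝ : t ≤ φ(s)} is a set of finite perimeter in (a,b) × ℝ. -/
open Set MeasureTheory

/-- A measurable set `E ⊆ ℝ²` has finite perimeter in the open set `U` if the integrals of
divergences of `C¹` compactly supported vector fields with values in the unit ball,
supported in `U`, over `E`, are bounded above by a finite constant. -/
def HasFinitePerimeterIn (E U : Set (ℝ × ℝ)) : Prop :=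
  ∃ C : ℝ, ∀ X : (ℝ × ℝ) → ℝ × ℝ, ContDiff ℝ 1 X → HasCompactSupport X →
    tsupport X ⊆ U → (∀ q, ‖X q‖ ≤ 1) →
    (∫ q in E, (fderiv ℝ (fun r => (X r).1) q (1, 0) +
        fderiv ℝ (fun r => (X r).2) q (0, 1))) ≤ C

open Filter Topology

theorem ContDiff.tendsto_setIntegral_slope {f : ℝ × ℝ → ℝ} (hf : ContDiff ℝ 1 f)
    (hc : HasCompactSupport f) {E : Set (ℝ × ℝ)} (hE : MeasurableSet E) (v : ℝ × ℝ) :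
    Tendsto (fun h : ℝ => ∫ q in E, h⁻¹ * (f (q + h • v) - f q)) (𝓝[>] 0)
      (𝓝 (∫ q in E, fderiv ℝ f q v)) := by
  obtain ⟨L, hL⟩ := ContDiff.lipschitzWith_of_hasCompactSupport hc hf one_ne_zero
  set K := Metric.cthickening ‖v‖ (tsupport f)
  have hKc : IsCompact K := IsCompact.cthickening hc
  have hfK : ∀ x ∉ K, ∀ h : ℝ, 0 ≤ h → h ≤ 1 → f (x + h • v) = 0 := by
    intro x hx h h0 h1
    by_contra hne
    apply hx
    refine Metric.mem_cthickening_of_dist_le x (x + h • v) _ _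
      (subset_tsupport _ hne) ?_
    rw [dist_self_add_right, norm_smul, Real.norm_of_nonneg h0]
    nlinarith [norm_nonneg v]
  have hg : Integrable ((E ∩ K).indicator fun _ => (1 : ℝ)) := by
    rw [integrable_indicator_iff (hE.inter hKc.isClosed.measurableSet)]
    exact integrableOn_const
      ((measure_mono inter_subset_right).trans_lt hKc.measure_lt_top).ne
  have key := hL.integral_inv_smul_sub_mul_tendsto_integral_lineDeriv_mul (μ := volume) hg v
  have hlim : ∫ x, lineDeriv ℝ f x v * (E ∩ K).indicator (fun _ => (1 : ℝ)) x =
      ∫ q in E, fderiv ℝ f q v := by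
    rw [← integral_indicator hE]
    refine integral_congr_ae (Eventually.of_forall fun x => ?_)
    have hd := (hf.differentiable one_ne_zero x).lineDeriv_eq_fderiv (v := v)
    by_cases hxE : x ∈ E <;> by_cases hxK : x ∈ K
    · simp [hxE, hxK, hd]
    · have : fderiv ℝ f x = 0 := by
        refine image_eq_zero_of_notMem_tsupport fun hx => hxK ?_
        exact Metric.self_subset_cthickening _ (tsupport_fderiv_subset ℝ hx)
      simp [hxE, hxK, this]
    · simp [hxE]
    · simp [hxE]
  rw [hlim] at key
  refine key.congr' ?_
  filter_upwards [Ioc_mem_nhdsGT (zero_lt_one' ℝ)] with h hh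
  rw [← integral_indicator hE]
  refine integral_congr_ae (Eventually.of_forall fun x => ?_)
  by_cases hxE : x ∈ E <;> by_cases hxK : x ∈ K
  · simp [hxE, hxK]
  · have h0 : f x = 0 := by simpa using hfK x hxK 0 le_rfl zero_le_one
    simp [hxE, hxK, h0, hfK x hxK h hh.1.le hh.2]
  · simp [hxE]
  · simp [hxE]

theorem ContDiff.setIntegral_fderiv_le {f : ℝ × ℝ → ℝ} (hf : ContDiff ℝ 1 f)
    (hc : HasCompactSupport f) (hb : ∀ q, |f q| ≤ 1) {E : Set (ℝ × ℝ)} (hE : MeasurableSet E)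
    (v : ℝ × ℝ) {C : ℝ} (hC : 0 ≤ C)
    (hEv : ∀ h : ℝ, 0 < h →
      volume (symmDiff ((fun q => q - h • v) ⁻¹' E) E) ≤ ENNReal.ofReal (h * C)) :
    ∫ q in E, fderiv ℝ f q v ≤ C := by
  refine le_of_tendsto (hf.tendsto_setIntegral_slope hc hE v) ?_
  filter_upwards [self_mem_nhdsWithin] with h hh
  have hh : 0 < h := hh
  set E' := (fun q => q - h • v) ⁻¹' E with hE'
  have hE'm : MeasurableSet E' := (measurable_sub_const _) hE
  have hfi : Integrable f := hf.continuous.integrable_of_hasCompactSupport hc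
  have hfi' : Integrable fun q => f (q + h • v) := hfi.comp_add_right (h • v)
  rw [integral_const_mul, inv_mul_le_iff₀ hh, integral_sub hfi'.integrableOn hfi.integrableOn]
  have h1 : ∫ q in E, f (q + h • v) = ∫ q in E', f q := by
    rw [← integral_indicator hE, ← integral_indicator hE'm,
      ← integral_add_right_eq_self (E'.indicator f) (h • v)]
    congr 1 with q
    have : q + h • v ∈ E' ↔ q ∈ E := by simp [hE', mem_preimage]
    by_cases hq : q ∈ E <;> simp [this, hq]
  rw [h1, ← integral_indicator hE, ← integral_indicator hE'm,
    ← integral_sub (hfi.indicator hE'm) (hfi.indicator hE)]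
  have hm : MeasurableSet (symmDiff E' E) := hE'm.symmDiff hE
  have hfin : volume (symmDiff E' E) ≠ ⊤ := ((hEv h hh).trans_lt ENNReal.ofReal_lt_top).ne
  calc ∫ q, (E'.indicator f q - E.indicator f q)
      ≤ ∫ q, (symmDiff E' E).indicator (fun _ => (1 : ℝ)) q := by
        refine integral_mono ((hfi.indicator hE'm).sub (hfi.indicator hE)) ?_ fun q => ?_
        · rw [integrable_indicator_iff hm]
          exact integrableOn_const hfin
        · have := abs_le.1 (hb q)
          by_cases h1 : q ∈ E' <;> by_cases h2 : q ∈ E <;>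
            simp [h1, h2, mem_symmDiff] <;> linarith
    _ = (volume (symmDiff E' E)).toReal := by
        rw [integral_indicator hm]; simp [Measure.real]
    _ ≤ h * C := ENNReal.toReal_le_of_le_ofReal (by positivity) (hEv h hh)

theorem measurableSet_subgraph {φ : ℝ → ℝ} (hφ : Measurable φ) :
    MeasurableSet {q : ℝ × ℝ | q.2 ≤ φ q.1} :=
  measurableSet_le measurable_snd (hφ.comp measurable_fst)

theorem volume_symmDiff_vertical_translate_subgraph_le {a b : ℝ} {φ : ℝ → ℝ}
    (hφ : Measurable φ) {h : ℝ} (hh : 0 < h) :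
    volume (symmDiff ((fun q => q - h • ((0, 1) : ℝ × ℝ)) ⁻¹'
        {q : ℝ × ℝ | q.1 ∈ Ioo a b ∧ q.2 ≤ φ q.1}) {q : ℝ × ℝ | q.1 ∈ Ioo a b ∧ q.2 ≤ φ q.1})
      ≤ ENNReal.ofReal (h * (b - a)) := by
  have hE : MeasurableSet {q : ℝ × ℝ | q.1 ∈ Ioo a b ∧ q.2 ≤ φ q.1} :=
    (measurable_fst measurableSet_Ioo).inter (measurableSet_subgraph hφ)
  rw [Measure.volume_eq_prod,
    Measure.prod_apply (((measurable_sub_const _) hE).symmDiff hE)]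
  calc _ ≤ ∫⁻ s, (Ioo a b).indicator (fun _ => ENNReal.ofReal h) s := by
        refine lintegral_mono fun s => ?_
        by_cases hs : s ∈ Ioo a b
        · rw [indicator_of_mem hs]
          calc _ ≤ volume (Icc (φ s) (φ s + h)) := by
                refine measure_mono fun t ht => ?_
                simp only [mem_preimage, mem_symmDiff, mem_ofPred_eq, Prod.fst_sub, Prod.snd_sub,
                  Prod.smul_fst, Prod.smul_snd, smul_eq_mul, mul_zero, mul_one, sub_zero, hs,
                  true_and, not_le] at ht
                constructor <;> rcases ht with ht | ht <;> linarith [ht.1, ht.2]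
            _ = _ := by simp
        · rw [indicator_of_notMem hs]
          refine (le_of_eq ?_)
          convert measure_empty (μ := (volume : Measure ℝ))
          ext t
          simp [-mem_Ioo, hs]
    _ = _ := by
        rw [lintegral_indicator measurableSet_Ioo]
        simp [ENNReal.ofReal_mul hh.le]

theorem volume_symmDiff_horizontal_translate_subgraph_le {c d : ℝ} (hcd : c ≤ d) {φ v : ℝ → ℝ}
    (hφ : Measurable φ) (hv : Monotone v) (hφv : ∀ x y, x ≤ y → |φ y - φ x| ≤ v y - v x)
    (hvc : ∀ x ≤ c, v x = v c) (hvd : ∀ x, d ≤ x → v x = v d) {h : ℝ} (hh : 0 < h) :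
    volume (symmDiff ((fun q => q - h • ((1, 0) : ℝ × ℝ)) ⁻¹' {q : ℝ × ℝ | q.2 ≤ φ q.1})
        {q : ℝ × ℝ | q.2 ≤ φ q.1})
      ≤ ENNReal.ofReal (h * (v d - v c)) := by
  have hE := measurableSet_subgraph hφ
  rw [Measure.volume_eq_prod,
    Measure.prod_apply (((measurable_sub_const _) hE).symmDiff hE)]
  have hvi : ∀ x y, IntervalIntegrable v volume x y := fun x y => hv.intervalIntegrable
  have hvi' : ∀ x y, IntervalIntegrable (fun s => v (s - h)) volume x y := fun x y =>
    (hv.comp fun _ _ hxy => sub_le_sub_right hxy h : Monotone fun s => v (s - h)).intervalIntegrable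
  have hcdh : c ≤ d + h := by linarith
  calc _ ≤ ∫⁻ s, (Ioc c (d + h)).indicator (fun s => ENNReal.ofReal (v s - v (s - h))) s := by
        refine lintegral_mono fun s => ?_
        have hs : v s - v (s - h) = 0 ∨ s ∈ Ioc c (d + h) := by
          by_cases h1 : s ≤ c
          · left; rw [hvc s h1, hvc (s - h) (by linarith), sub_self]
          by_cases h2 : d + h < s
          · left; rw [hvd s (by linarith), hvd (s - h) (by linarith), sub_self]
          · right; exact ⟨not_le.1 h1, not_lt.1 h2⟩
        have : (Ioc c (d + h)).indicator (fun s => ENNReal.ofReal (v s - v (s - h))) s =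
            ENNReal.ofReal (v s - v (s - h)) := by
          rcases hs with hs | hs
          · by_cases h1 : s ∈ Ioc c (d + h) <;> simp [indicator, hs]
          · rw [indicator_of_mem hs]
        rw [this]
        calc _ ≤ volume (uIcc (φ (s - h)) (φ s)) := by
              refine measure_mono fun t ht => ?_
              simp only [mem_preimage, mem_symmDiff, mem_ofPred_eq, Prod.fst_sub, Prod.snd_sub,
                Prod.smul_fst, Prod.smul_snd, smul_eq_mul, mul_zero, mul_one, sub_zero,
                not_le] at ht
              rw [mem_uIcc]
              rcases ht with ht | ht
              · exact Or.inr ⟨ht.2.le, ht.1⟩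
              · exact Or.inl ⟨ht.2.le, ht.1⟩
          _ ≤ _ := by
              rw [Real.volume_interval]
              exact ENNReal.ofReal_le_ofReal (hφv _ _ (by linarith))
    _ = ENNReal.ofReal (∫ s in c..d + h, (v s - v (s - h))) := by
        rw [lintegral_indicator measurableSet_Ioc, intervalIntegral.integral_of_le hcdh,
          ofReal_integral_eq_lintegral_ofReal]
        · exact ((hvi c (d + h)).sub (hvi' c (d + h))).1
        · exact Eventually.of_forall fun s => sub_nonneg.2 (hv (by linarith))
    _ = ENNReal.ofReal (h * (v d - v c)) := by
        congr 1
        rw [intervalIntegral.integral_sub (hvi _ _) (hvi' _ _),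
          intervalIntegral.integral_comp_sub_right v h, add_sub_cancel_right,
          ← intervalIntegral.integral_add_adjacent_intervals (hvi c d) (hvi d (d + h)),
          ← intervalIntegral.integral_add_adjacent_intervals (hvi (c - h) c) (hvi c d)]
        have e1 : ∫ s in d..d + h, v s = h * v d := by
          rw [intervalIntegral.integral_congr (g := fun _ => v d)]
          · simp
          · intro s hs
            rw [uIcc_of_le (by linarith)] at hs
            exact hvd s hs.1
        have e2 : ∫ s in c - h..c, v s = h * v c := by
          rw [intervalIntegral.integral_congr (g := fun _ => v c)]
          · simp
          · intro s hs
            rw [uIcc_of_le (by linarith)] at hs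
            exact hvc s hs.2
        rw [e1, e2]; ring

theorem HasFinitePerimeterIn.congr_ae {E E' U : Set (ℝ × ℝ)}
    (h : E =ᵐ[volume] E') : HasFinitePerimeterIn E U ↔ HasFinitePerimeterIn E' U := by
  simp only [HasFinitePerimeterIn, setIntegral_congr_set h]

theorem subgraph_ae_eq {a b : ℝ} {φ ψ : ℝ → ℝ}
    (h : ∀ᵐ s ∂(volume.restrict (Ioo a b)), φ s = ψ s) :
    ({q : ℝ × ℝ | q.1 ∈ Ioo a b ∧ q.2 ≤ φ q.1} : Set (ℝ × ℝ)) =ᵐ[volume]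
      {q : ℝ × ℝ | q.1 ∈ Ioo a b ∧ q.2 ≤ ψ q.1} := by
  rw [ae_restrict_iff' measurableSet_Ioo] at h
  have h2 := (Measure.quasiMeasurePreserving_fst (μ := (volume : Measure ℝ))
    (ν := (volume : Measure ℝ))).ae h
  rw [eventuallyEq_set]
  filter_upwards [h2] with q hq
  exact and_congr_right fun hs => by rw [hq hs]

theorem IsCompact.exists_subset_Icc_of_subset_Ioo {K : Set ℝ} (hK : IsCompact K) {a b : ℝ}
    (hab : a < b) (h : K ⊆ Ioo a b) : ∃ c d, a < c ∧ c ≤ d ∧ d < b ∧ K ⊆ Icc c d := by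
  rcases K.eq_empty_or_nonempty with rfl | hne
  · obtain ⟨c, hc⟩ := exists_between hab
    exact ⟨c, c, hc.1, le_rfl, hc.2, empty_subset _⟩
  · obtain ⟨c, hc⟩ := hK.exists_isLeast hne
    obtain ⟨d, hd⟩ := hK.exists_isGreatest hne
    exact ⟨c, d, (h hc.1).1, hc.2 hd.1, (h hd.1).2, fun x hx => ⟨hc.2 hx, hd.2 hx⟩⟩

theorem BoundedVariationOn.exists_extension_dominated {a b : ℝ} {ψ : ℝ → ℝ}
    (hψ : BoundedVariationOn ψ (Ioo a b)) {c d : ℝ} (hac : a < c) (hcd : c ≤ d) (hdb : d < b) :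
    ∃ f v : ℝ → ℝ, EqOn f ψ (Icc c d) ∧ Measurable f ∧ Monotone v ∧
      (∀ x y, x ≤ y → |f y - f x| ≤ v y - v x) ∧ (∀ x ≤ c, v x = v c) ∧
      (∀ x, d ≤ x → v x = v d) ∧ v d - v c ≤ (eVariationOn ψ (Ioo a b)).toReal := by
  have hl := hψ.locallyBoundedVariationOn
  have hsub : Icc c d ⊆ Ioo a b := Icc_subset_Ioo hac hdb
  have hmem : ∀ x, (projIcc c d hcd x : ℝ) ∈ Ioo a b := fun x => hsub (projIcc c d hcd x).2
  have hmono : Monotone fun x => (projIcc c d hcd x : ℝ) := fun x y h => monotone_projIcc hcd h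
  have hc : c ∈ Ioo a b := hsub (left_mem_Icc.2 hcd)
  have hd : d ∈ Ioo a b := hsub (right_mem_Icc.2 hcd)
  set w := variationOnFromTo ψ (Ioo a b) c with hw
  have hwψ : ∀ x ∈ Ioo a b, ∀ y ∈ Ioo a b, x ≤ y → |ψ y - ψ x| ≤ w y - w x := by
    intro x hx y hy hxy
    have h1 := variationOnFromTo.add_self_monotoneOn hl hc hx hy hxy
    have h2 := variationOnFromTo.sub_self_monotoneOn hl hc hx hy hxy
    simp only [Pi.add_apply, Pi.sub_apply, ← hw] at h1 h2
    rw [abs_le]; constructor <;> linarith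
  have hv : Monotone fun x => w (projIcc c d hcd x) := fun x y h =>
    variationOnFromTo.monotoneOn hl hc (hmem x) (hmem y) (hmono h)
  have hvf : Monotone fun x => w (projIcc c d hcd x) - ψ (projIcc c d hcd x) := fun x y h =>
    variationOnFromTo.sub_self_monotoneOn hl hc (hmem x) (hmem y) (hmono h)
  refine ⟨fun x => ψ (projIcc c d hcd x), fun x => w (projIcc c d hcd x), ?_, ?_, hv, ?_, ?_, ?_, ?_⟩
  · intro x hx
    simp [projIcc_of_mem hcd hx]
  · convert hv.measurable.sub hvf.measurable using 1
    ext x; simp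
  · exact fun x y h => hwψ _ (hmem x) _ (hmem y) (hmono h)
  · intro x hx
    simp [projIcc_of_le_left hcd hx]
  · intro x hx
    simp [projIcc_of_right_le hcd hx]
  · simp only [projIcc_left, projIcc_right, hw, variationOnFromTo.self, sub_zero]
    rw [variationOnFromTo.eq_of_le _ _ hcd]
    exact ENNReal.toReal_mono hψ (eVariationOn.mono _ inter_subset_left)

theorem BoundedVariationOn.hasFinitePerimeterIn_subgraph {a b : ℝ} (hab : a < b) {φ ψ : ℝ → ℝ}
    (hφ : Measurable φ) (hae : ∀ᵐ s ∂(volume.restrict (Ioo a b)), ψ s = φ s)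
    (hψ : BoundedVariationOn ψ (Ioo a b)) :
    HasFinitePerimeterIn {q : ℝ × ℝ | q.1 ∈ Ioo a b ∧ q.2 ≤ φ q.1}
      (Ioo a b ×ˢ (univ : Set ℝ)) := by
  refine ⟨(eVariationOn ψ (Ioo a b)).toReal + (b - a), fun X hX hXc hXs hXb => ?_⟩
  obtain ⟨c, d, hac, hcd, hdb, hK⟩ := (hXc.isCompact.image continuous_fst
    ).exists_subset_Icc_of_subset_Ioo hab (by rintro _ ⟨q, hq, rfl⟩; exact (hXs hq).1)
  obtain ⟨f, v, hfψ, hf, hv, hfv, hvc, hvd, hV⟩ := hψ.exists_extension_dominated hac hcd hdb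
  set E := {q : ℝ × ℝ | q.1 ∈ Ioo a b ∧ q.2 ≤ φ q.1} with hEdef
  have hE : MeasurableSet E :=
    (measurable_fst measurableSet_Ioo).inter (measurableSet_subgraph hφ)
  have h1 : ContDiff ℝ 1 fun r => (X r).1 := contDiff_fst.comp hX
  have h2 : ContDiff ℝ 1 fun r => (X r).2 := contDiff_snd.comp hX
  have hc1 : HasCompactSupport fun r => (X r).1 := hXc.comp_left (g := Prod.fst) rfl
  have hc2 : HasCompactSupport fun r => (X r).2 := hXc.comp_left (g := Prod.snd) rfl
  have hi1 : Integrable fun q => fderiv ℝ (fun r => (X r).1) q (1, 0) :=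
    ((h1.continuous_fderiv one_ne_zero).clm_apply continuous_const).integrable_of_hasCompactSupport
      (hc1.fderiv_apply ℝ _)
  have hi2 : Integrable fun q => fderiv ℝ (fun r => (X r).2) q (0, 1) :=
    ((h2.continuous_fderiv one_ne_zero).clm_apply continuous_const).integrable_of_hasCompactSupport
      (hc2.fderiv_apply ℝ _)
  rw [integral_add hi1.integrableOn hi2.integrableOn]
  refine add_le_add ?_ ?_
  · have hE' := measurableSet_subgraph hf
    have heq : ∫ q in E, fderiv ℝ (fun r => (X r).1) q (1, 0) =
        ∫ q in {q : ℝ × ℝ | q.2 ≤ f q.1}, fderiv ℝ (fun r => (X r).1) q (1, 0) := by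
      rw [← integral_indicator hE, ← integral_indicator hE']
      refine integral_congr_ae ?_
      rw [ae_restrict_iff' measurableSet_Ioo] at hae
      filter_upwards [(Measure.quasiMeasurePreserving_fst (μ := (volume : Measure ℝ))
        (ν := (volume : Measure ℝ))).ae hae] with q hq
      by_cases hqX : q ∈ tsupport X
      · have hq1 := hK (mem_image_of_mem _ hqX)
        have hq2 := Icc_subset_Ioo hac hdb hq1
        have : q ∈ E ↔ q ∈ {q : ℝ × ℝ | q.2 ≤ f q.1} := by
          simp only [hEdef, mem_ofPred_eq, hfψ hq1, hq hq2, hq2, true_and]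
        by_cases hqE : q ∈ E
        · rw [indicator_of_mem hqE, indicator_of_mem (this.1 hqE)]
        · rw [indicator_of_notMem hqE, indicator_of_notMem (fun h => hqE (this.2 h))]
      · have : fderiv ℝ (fun r => (X r).1) q = 0 := by
          refine image_eq_zero_of_notMem_tsupport fun hx => hqX ?_
          exact tsupport_comp_subset (g := Prod.fst) rfl X (tsupport_fderiv_subset ℝ hx)
        simp [indicator, this]
    rw [heq]
    refine (h1.setIntegral_fderiv_le hc1 (fun q => ?_) hE' (1, 0) (sub_nonneg.2 (hv hcd))
      fun h hh => volume_symmDiff_horizontal_translate_subgraph_le hcd hf hv hfv hvc hvd hh).trans hV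
    exact (norm_fst_le (X q)).trans (hXb q)
  · refine h2.setIntegral_fderiv_le hc2 (fun q => ?_) hE (0, 1) (by linarith)
      fun h hh => volume_symmDiff_vertical_translate_subgraph_le hφ hh
    exact (norm_snd_le (X q)).trans (hXb q)

theorem fderiv_mul_fst_snd_apply {ξ η : ℝ → ℝ} (hξ : Differentiable ℝ ξ)
    (hη : Differentiable ℝ η) (q : ℝ × ℝ) :
    fderiv ℝ (fun r : ℝ × ℝ => ξ r.1 * η r.2) q (1, 0) = deriv ξ q.1 * η q.2 := by
  have h1 := (hξ q.1).hasDerivAt.comp_hasFDerivAt q (hasFDerivAt_fst (𝕜 := ℝ) (p := q))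
  have h2 := (hη q.2).hasDerivAt.comp_hasFDerivAt q (hasFDerivAt_snd (𝕜 := ℝ) (p := q))
  have h3 := (h1.mul h2).fderiv
  simp only [Function.comp_def] at h3
  change fderiv ℝ ((fun r : ℝ × ℝ => ξ r.1) * fun r : ℝ × ℝ => η r.2) q (1, 0) = _
  rw [h3]
  simp [mul_comm]

theorem integral_deriv_eq_zero_of_hasCompactSupport {ξ : ℝ → ℝ} (hξ : ContDiff ℝ 1 ξ)
    (hc : HasCompactSupport ξ) : ∫ s, deriv ξ s = 0 :=
  integral_eq_zero_of_hasDerivAt_of_integrable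
    (fun x => (hξ.differentiable one_ne_zero x).hasDerivAt)
    ((hξ.continuous_deriv le_rfl).integrable_of_hasCompactSupport hc.deriv)
    (hξ.continuous.integrable_of_hasCompactSupport hc)

theorem setIntegral_subgraph_deriv_mul {a b : ℝ} {φ : ℝ → ℝ} (hφ : Measurable φ)
    (hφi : IntegrableOn φ (Ioo a b)) {ξ η : ℝ → ℝ} (hξ : ContDiff ℝ 1 ξ)
    (hξc : HasCompactSupport ξ) (hξs : tsupport ξ ⊆ Ioo a b) (hη : Continuous η)
    (hηc : HasCompactSupport η) (hη1 : ∀ t, ‖η t‖ ≤ 1) :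
    ∫ q in {q : ℝ × ℝ | q.1 ∈ Ioo a b ∧ q.2 ≤ φ q.1}, deriv ξ q.1 * η q.2 =
      ∫ s in Ioo a b, deriv ξ s * ∫ t in (0)..φ s, η t := by
  set E := {q : ℝ × ℝ | q.1 ∈ Ioo a b ∧ q.2 ≤ φ q.1} with hEdef
  have hE : MeasurableSet E :=
    (measurable_fst measurableSet_Ioo).inter (measurableSet_subgraph hφ)
  have hξ' : Continuous (deriv ξ) := hξ.continuous_deriv le_rfl
  have hξ'i : Integrable (deriv ξ) := hξ'.integrable_of_hasCompactSupport hξc.deriv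
  have hηi : Integrable η := hη.integrable_of_hasCompactSupport hηc
  have hFi : Integrable (fun q : ℝ × ℝ => deriv ξ q.1 * η q.2) := hξ'i.mul_prod hηi
  have h1 : ∫ q in E, deriv ξ q.1 * η q.2 =
      ∫ s in Ioo a b, deriv ξ s * ∫ t in Iic (φ s), η t := by
    rw [← integral_indicator hE, Measure.volume_eq_prod,
      integral_prod _ (hFi.indicator hE), ← integral_indicator measurableSet_Ioo]
    congr 1 with s
    by_cases hs : s ∈ Ioo a b
    · rw [indicator_of_mem hs, ← integral_const_mul, ← integral_indicator measurableSet_Iic]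
      congr 1 with t
      have : (s, t) ∈ E ↔ t ∈ Iic (φ s) := by simp [hEdef, -mem_Ioo, hs]
      by_cases ht : t ∈ Iic (φ s)
      · rw [indicator_of_mem ht, indicator_of_mem (this.2 ht)]
      · rw [indicator_of_notMem ht, indicator_of_notMem (fun h => ht (this.1 h))]
    · rw [indicator_of_notMem hs]
      have : ∀ t, (s, t) ∉ E := fun t h => hs h.1
      simp [this]
  have h2 : ∀ s, ∫ t in Iic (φ s), η t = (∫ t in Iic 0, η t) + ∫ t in (0)..φ s, η t := fun s => by
    rw [← intervalIntegral.integral_Iic_sub_Iic hηi.integrableOn hηi.integrableOn]; ring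
  obtain ⟨M, hM⟩ := hξc.deriv.exists_bound_of_continuous hξ'
  have hHc : Continuous fun y : ℝ => ∫ t in (0)..y, η t :=
    intervalIntegral.continuous_primitive (fun x y => hη.intervalIntegrable x y) 0
  have hH : IntegrableOn (fun s => ∫ t in (0)..φ s, η t) (Ioo a b) := by
    refine Integrable.mono hφi (hHc.measurable.comp hφ).aestronglyMeasurable
      (Eventually.of_forall fun s => ?_)
    simpa using intervalIntegral.norm_integral_le_of_norm_le_const
      (a := 0) (b := φ s) fun t _ => hη1 t
  have hmi : IntegrableOn (fun s => deriv ξ s * ∫ t in (0)..φ s, η t) (Ioo a b) :=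
    Integrable.bdd_mul hH hξ'.aestronglyMeasurable (Eventually.of_forall hM)
  rw [h1]
  simp only [h2, mul_add]
  rw [integral_add (hξ'i.integrableOn.mul_const _) hmi, integral_mul_const,
    setIntegral_eq_integral_of_forall_compl_eq_zero,
    integral_deriv_eq_zero_of_hasCompactSupport hξ hξc, zero_mul, zero_add]
  intro x hx
  exact image_eq_zero_of_notMem_tsupport fun h => hx (hξs (tsupport_deriv_subset h))

theorem exists_integral_deriv_mul_le_of_hasFinitePerimeterIn {a b : ℝ} {φ : ℝ → ℝ}
    (hφ : Measurable φ) (hφi : IntegrableOn φ (Ioo a b))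
    (hE : HasFinitePerimeterIn {q : ℝ × ℝ | q.1 ∈ Ioo a b ∧ q.2 ≤ φ q.1}
      (Ioo a b ×ˢ (univ : Set ℝ))) :
    ∃ C : ℝ, ∀ ξ : ℝ → ℝ, ContDiff ℝ 1 ξ → HasCompactSupport ξ → tsupport ξ ⊆ Ioo a b →
      (∀ s, |ξ s| ≤ 1) → ∫ s in Ioo a b, deriv ξ s * φ s ≤ C := by
  obtain ⟨C, hC⟩ := hE
  refine ⟨C, fun ξ hξ hξc hξs hξb => ?_⟩
  let η : ℕ → ContDiffBump (0 : ℝ) := fun n =>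
    ⟨n + 1, n + 2, by positivity, by linarith⟩
  have hη1 : ∀ n t, ‖η n t‖ ≤ 1 := fun n t => by
    rw [Real.norm_of_nonneg (η n).nonneg]; exact (η n).le_one
  have hηd : ∀ n, ContDiff ℝ 1 (η n) := fun n => (η n).contDiff
  have hξ' : Continuous (deriv ξ) := hξ.continuous_deriv le_rfl
  obtain ⟨M, hM⟩ := hξc.deriv.exists_bound_of_continuous hξ'
  have hlim : Tendsto (fun n => ∫ s in Ioo a b, deriv ξ s * ∫ t in (0)..φ s, η n t) atTop
      (𝓝 (∫ s in Ioo a b, deriv ξ s * φ s)) := by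
    refine tendsto_integral_of_dominated_convergence (fun s => M * ‖φ s‖) (fun n => ?_)
      (hφi.norm.const_mul M) (fun n => Eventually.of_forall fun s => ?_)
      (Eventually.of_forall fun s => ?_)
    · have hHc : Continuous fun y : ℝ => ∫ t in (0)..y, η n t :=
        intervalIntegral.continuous_primitive
          (fun x y => (hηd n).continuous.intervalIntegrable x y) 0
      exact hξ'.aestronglyMeasurable.mul (hHc.measurable.comp hφ).aestronglyMeasurable
    · rw [norm_mul]
      refine mul_le_mul (hM s) ?_ (norm_nonneg _) ((norm_nonneg _).trans (hM s))
      simpa using intervalIntegral.norm_integral_le_of_norm_le_const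
        (a := 0) (b := φ s) fun t _ => hη1 n t
    · refine Tendsto.const_mul _ (tendsto_const_nhds.congr' ?_)
      filter_upwards [eventually_ge_atTop ⌈|φ s|⌉₊] with n hn
      have hn' : |φ s| ≤ n := (Nat.le_ceil _).trans (by exact_mod_cast hn)
      rw [intervalIntegral.integral_congr (g := fun _ => (1 : ℝ))]
      · simp
      · intro t ht
        refine (η n).one_of_mem_closedBall ?_
        have h1 : |t| ≤ |φ s| := by
          simpa using abs_sub_left_of_mem_uIcc ht
        simp only [mem_closedBall_zero_iff, Real.norm_eq_abs, η]
        linarith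
  refine le_of_tendsto hlim (Eventually.of_forall fun n => ?_)
  rw [← setIntegral_subgraph_deriv_mul hφ hφi hξ hξc hξs (hηd n).continuous
    (η n).hasCompactSupport (hη1 n)]
  have hsupp : Function.support (fun q : ℝ × ℝ => (ξ q.1 * η n q.2, (0 : ℝ))) ⊆
      tsupport ξ ×ˢ tsupport (η n) := by
    intro q hq
    have : ξ q.1 ≠ 0 ∧ η n q.2 ≠ 0 := by simpa using hq
    exact ⟨subset_tsupport _ this.1, subset_tsupport _ this.2⟩
  have hclosed : IsClosed (tsupport ξ ×ˢ tsupport (η n)) :=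
    (isClosed_tsupport _).prod (isClosed_tsupport _)
  have key := hC (fun q => (ξ q.1 * η n q.2, 0))
    (((hξ.comp contDiff_fst).mul ((hηd n).comp contDiff_snd)).prodMk contDiff_const)
    ((hξc.isCompact.prod (η n).hasCompactSupport.isCompact).of_isClosed_subset
      (isClosed_tsupport _) (closure_minimal hsupp hclosed))
    ((closure_minimal hsupp hclosed).trans (prod_mono hξs (subset_univ _)))
    (fun q => by
      have : |ξ q.1| * |η n q.2| ≤ 1 := mul_le_one₀ (hξb _) (abs_nonneg _) (hη1 n _)
      simpa [Prod.norm_def, abs_mul] using this)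
  simpa [fderiv_mul_fst_snd_apply (hξ.differentiable one_ne_zero)
    ((hηd n).differentiable one_ne_zero)] using key

theorem sum_abs_sub_mollified_le {a b C : ℝ} {φ : ℝ → ℝ} (hφi : IntegrableOn φ (Ioo a b))
    (hC : ∀ ξ : ℝ → ℝ, ContDiff ℝ 1 ξ → HasCompactSupport ξ → tsupport ξ ⊆ Ioo a b →
      (∀ s, |ξ s| ≤ 1) → ∫ s in Ioo a b, deriv ξ s * φ s ≤ C)
    {ρ : ℝ → ℝ} (hρ : Continuous ρ) (hρ0 : ∀ t, 0 ≤ ρ t) (hρi : Integrable ρ)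
    (hρ1 : ∫ t, ρ t = 1) {r : ℝ} (hρr : ∀ t, r ≤ |t| → ρ t = 0) {u : ℕ → ℝ} (hu : Monotone u)
    {N : ℕ} (ha : a < u 0 - r) (hb : u N + r < b) :
    ∑ i ∈ Finset.range N, |(∫ t in Ioo a b, ρ (u (i + 1) - t) * φ t) -
      ∫ t in Ioo a b, ρ (u i - t) * φ t| ≤ C := by
  set M : ℝ → ℝ := fun x => ∫ t in Ioo a b, ρ (x - t) * φ t
  let P : ℝ → ℝ := fun y => ∫ t in (0)..y, ρ t
  have hii : ∀ x y, IntervalIntegrable ρ volume x y := fun x y => hρ.intervalIntegrable x y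
  have hP : ∀ y, HasDerivAt P (ρ y) y := fun y =>
    intervalIntegral.integral_hasDerivAt_right (hii 0 y)
      (hρ.stronglyMeasurableAtFilter _ _) hρ.continuousAt
  have hPsub : ∀ x y, P y - P x = ∫ t in x..y, ρ t := fun x y =>
    intervalIntegral.integral_interval_sub_left (hii _ _) (hii _ _)
  have hPmono : Monotone P := monotone_of_deriv_nonneg (fun y => (hP y).differentiableAt)
    fun y => by rw [(hP y).deriv]; exact hρ0 y
  have hP1 : ∀ x y, x ≤ y → P y - P x ≤ 1 := fun x y hxy => by
    rw [hPsub, intervalIntegral.integral_of_le hxy, ← hρ1]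
    exact setIntegral_le_integral hρi (Eventually.of_forall hρ0)
  have hPeq : ∀ x y, (r ≤ x ∧ r ≤ y) ∨ (x ≤ -r ∧ y ≤ -r) → P y - P x = 0 := fun x y h => by
    rw [hPsub, intervalIntegral.integral_congr (g := fun _ => (0 : ℝ))]
    · simp
    · intro t ht
      refine hρr t ?_
      rw [mem_uIcc] at ht
      rw [le_abs]
      rcases h with h | h <;> rcases ht with ht | ht
      · left; linarith
      · left; linarith
      · right; linarith
      · right; linarith
  have hPc : ContDiff ℝ 1 P := contDiff_one_iff_deriv.2
    ⟨fun y => (hP y).differentiableAt, by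
      rw [show deriv P = ρ from funext fun y => (hP y).deriv]; exact hρ⟩
  let σ : ℕ → ℝ := fun i => SignType.sign (M (u (i + 1)) - M (u i))
  have hσ : ∀ i, |σ i| ≤ 1 := fun i => by
    simp only [σ]
    rcases SignType.sign (M (u (i + 1)) - M (u i)) with _ | _ | _ <;> simp
  let ξ : ℝ → ℝ := fun s => -∑ i ∈ Finset.range N, σ i * (P (u (i + 1) - s) - P (u i - s))
  have hξd : ∀ s, HasDerivAt ξ (∑ i ∈ Finset.range N, σ i * (ρ (u (i + 1) - s) - ρ (u i - s))) s := by
    intro s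
    have h1 : ∀ x : ℝ, HasDerivAt (fun s => P (x - s)) (-ρ (x - s)) s := fun x =>
      (hP (x - s)).comp_const_sub x s
    have h2 := (HasDerivAt.fun_sum fun i (_ : i ∈ Finset.range N) =>
      ((h1 (u (i + 1))).fun_sub (h1 (u i))).const_mul (σ i)).fun_neg
    refine h2.congr_deriv ?_
    rw [← Finset.sum_neg_distrib]
    exact Finset.sum_congr rfl fun i _ => by ring
  have hξc : ContDiff ℝ 1 ξ := by
    refine (ContDiff.sum fun i _ => contDiff_const.mul ?_).neg
    exact (hPc.comp (contDiff_const.sub contDiff_id)).sub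
      (hPc.comp (contDiff_const.sub contDiff_id))
  have hξ1 : ∀ s, |ξ s| ≤ 1 := fun s => by
    have hstep : ∀ i, 0 ≤ P (u (i + 1) - s) - P (u i - s) := fun i =>
      sub_nonneg.2 (hPmono (sub_le_sub_right (hu i.le_succ) s))
    calc |ξ s| ≤ ∑ i ∈ Finset.range N, |σ i * (P (u (i + 1) - s) - P (u i - s))| := by
          simp only [ξ, abs_neg]
          exact Finset.abs_sum_le_sum_abs _ _
      _ ≤ ∑ i ∈ Finset.range N, (P (u (i + 1) - s) - P (u i - s)) := by
          refine Finset.sum_le_sum fun i _ => ?_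
          rw [abs_mul, abs_of_nonneg (hstep i)]
          exact mul_le_of_le_one_left (hstep i) (hσ i)
      _ = P (u N - s) - P (u 0 - s) := Finset.sum_range_sub (fun i => P (u i - s)) N
      _ ≤ 1 := hP1 _ _ (sub_le_sub_right (hu N.zero_le) s)
  have hξs : Function.support ξ ⊆ Icc (u 0 - r) (u N + r) := by
    intro s hs
    by_contra hns
    refine hs (neg_eq_zero.2 (Finset.sum_eq_zero fun i hi => ?_))
    have hi' : i + 1 ≤ N := Finset.mem_range.1 hi
    have h0 := hu i.zero_le
    have h1 := hu i.le_succ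
    have h2 := hu hi'
    rw [hPeq, mul_zero]
    simp only [Nat.succ_eq_add_one] at h1
    rw [mem_Icc, not_and_or, not_le, not_le] at hns
    rcases hns with h | h
    · left; constructor <;> linarith
    · right; constructor <;> linarith
  have hts : tsupport ξ ⊆ Icc (u 0 - r) (u N + r) := closure_minimal hξs isClosed_Icc
  have key := hC ξ hξc (isCompact_Icc.of_isClosed_subset (isClosed_tsupport _) hts)
    (hts.trans (Icc_subset_Ioo ha hb)) hξ1
  refine le_of_eq_of_le ?_ key
  obtain ⟨B, hB⟩ : ∃ B, ∀ t, ‖ρ t‖ ≤ B := by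
    refine HasCompactSupport.exists_bound_of_continuous ?_ hρ
    refine HasCompactSupport.intro (isCompact_Icc (a := -r) (b := r)) fun t ht => hρr t ?_
    rw [mem_Icc, ← abs_le, not_le] at ht
    exact ht.le
  have hint : ∀ x, IntegrableOn (fun t => ρ (x - t) * φ t) (Ioo a b) := fun x =>
    Integrable.bdd_mul hφi (hρ.comp (continuous_const.sub continuous_id)).aestronglyMeasurable
      (Eventually.of_forall fun t => hB (x - t))
  have hrw : ∀ s, deriv ξ s * φ s = ∑ i ∈ Finset.range N,
      σ i * (ρ (u (i + 1) - s) * φ s - ρ (u i - s) * φ s) := fun s => by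
    rw [(hξd s).deriv, Finset.sum_mul]
    exact Finset.sum_congr rfl fun i _ => by ring
  simp only [hrw]
  rw [integral_finsetSum (f := fun i s => σ i * (ρ (u (i + 1) - s) * φ s - ρ (u i - s) * φ s)) _
    fun i _ => ((hint _).sub (hint _)).const_mul _]
  refine Finset.sum_congr rfl fun i _ => ?_
  rw [integral_const_mul, integral_sub (hint _) (hint _)]
  exact (sign_mul_self _).symm

theorem exists_ae_eVariationOn_le_of_integral_deriv_mul_le {a b C : ℝ} {φ : ℝ → ℝ}
    (hφi : IntegrableOn φ (Ioo a b))
    (hC : ∀ ξ : ℝ → ℝ, ContDiff ℝ 1 ξ → HasCompactSupport ξ → tsupport ξ ⊆ Ioo a b →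
      (∀ s, |ξ s| ≤ 1) → ∫ s in Ioo a b, deriv ξ s * φ s ≤ C) :
    ∃ L ⊆ Ioo a b, (∀ᵐ s ∂(volume.restrict (Ioo a b)), s ∈ L) ∧ BoundedVariationOn φ L := by
  let B : ℕ → ContDiffBump (0 : ℝ) := fun n =>
    ⟨1 / ((n : ℝ) + 1), 2 * (1 / ((n : ℝ) + 1)), by positivity, by
      have : 0 < 1 / ((n : ℝ) + 1) := by positivity
      linarith⟩
  have hBlim : Tendsto (fun n => (B n).rOut) atTop (𝓝 0) := by
    simpa [B] using (tendsto_one_div_add_atTop_nhds_zero_nat (𝕜 := ℝ)).const_mul 2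
  have hconv := ContDiffBump.ae_convolution_tendsto_right_of_locallyIntegrable (μ := volume)
    hBlim (K := 2) (Eventually.of_forall fun n => le_rfl)
    ((integrable_indicator_iff measurableSet_Ioo).2 hφi).locallyIntegrable
  have hconv_eq : ∀ n x, (convolution ((B n).normed volume) ((Ioo a b).indicator φ)
      (ContinuousLinearMap.lsmul ℝ ℝ) volume) x =
        ∫ t in Ioo a b, (B n).normed volume (x - t) * φ t := fun n x => by
    rw [convolution_eq_swap, ← integral_indicator measurableSet_Ioo]
    congr 1 with t
    by_cases ht : t ∈ Ioo a b
    · simp only [indicator_of_mem ht]; simp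
    · simp only [indicator_of_notMem ht]; simp
  simp only [hconv_eq] at hconv
  refine ⟨{x ∈ Ioo a b | Tendsto (fun n => ∫ t in Ioo a b, (B n).normed volume (x - t) * φ t)
    atTop (𝓝 (φ x))}, fun x hx => hx.1, ?_, ?_⟩
  · rw [ae_restrict_iff' measurableSet_Ioo]
    filter_upwards [hconv] with x hx hxI
    rw [indicator_of_mem hxI] at hx
    exact ⟨hxI, hx⟩
  · refine ne_top_of_le_ne_top (ENNReal.ofReal_ne_top (r := C)) (iSup_le ?_)
    rintro ⟨N, u, hu, huL⟩
    simp only [edist_dist, Real.dist_eq]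
    rw [← ENNReal.ofReal_sum_of_nonneg fun _ _ => abs_nonneg _]
    refine ENNReal.ofReal_le_ofReal ?_
    refine le_of_tendsto (tendsto_finsetSum _ fun i _ =>
      (((huL (i + 1)).2.sub (huL i).2).abs)) ?_
    filter_upwards [hBlim.eventually_lt_const (sub_pos.2 (huL 0).1.1),
      hBlim.eventually_lt_const (sub_pos.2 (huL N).1.2)] with n h1 h2
    refine sum_abs_sub_mollified_le hφi hC (B n).continuous_normed (B n).nonneg_normed
      (B n).integrable_normed (B n).integral_normed (r := (B n).rOut) (fun t ht => ?_) hu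
      (by linarith) (by linarith)
    rw [← Function.notMem_support, (B n).support_normed_eq]
    simpa using ht

theorem BoundedVariationOn.exists_eqOn_Icc {L : Set ℝ} {φ : ℝ → ℝ} (hφ : BoundedVariationOn φ L)
    {a b : ℝ} : ∃ ψ : ℝ → ℝ, EqOn ψ φ L ∧ BoundedVariationOn ψ (Icc a b) := by
  rcases L.eq_empty_or_nonempty with rfl | ⟨c, hc⟩
  · exact ⟨fun _ => 0, eqOn_empty _ _,
      ((monotone_const (c := (0 : ℝ))).monotoneOn _).boundedVariationOn (C := 0) (by simp)⟩
  have hl := hφ.locallyBoundedVariationOn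
  set V := (eVariationOn φ L).toReal
  have hw : ∀ x, |variationOnFromTo φ L c x| ≤ V := fun x => by
    have h : ∀ y z, (eVariationOn φ (L ∩ Icc y z)).toReal ≤ V := fun y z =>
      ENNReal.toReal_mono hφ (eVariationOn.mono _ inter_subset_left)
    rcases le_total c x with h' | h'
    · rw [variationOnFromTo.eq_of_le _ _ h', abs_of_nonneg ENNReal.toReal_nonneg]; exact h _ _
    · rw [variationOnFromTo.eq_of_ge _ _ h', abs_neg, abs_of_nonneg ENNReal.toReal_nonneg]
      exact h _ _
  have hφb : ∀ x ∈ L, |φ x - φ c| ≤ V := fun x hx => hφ.dist_le hx hc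
  have hext : ∀ (f : ℝ → ℝ) (K : ℝ), MonotoneOn f L → (∀ x ∈ L, |f x| ≤ K) →
      ∃ g : ℝ → ℝ, Monotone g ∧ EqOn f g L := fun f K hf hK => by
    refine hf.exists_monotone_extension ⟨-K, ?_⟩ ⟨K, ?_⟩
    · rintro _ ⟨x, hx, rfl⟩; exact (abs_le.1 (hK x hx)).1
    · rintro _ ⟨x, hx, rfl⟩; exact (abs_le.1 (hK x hx)).2
  obtain ⟨p, hp, hpw⟩ := hext _ V (variationOnFromTo.monotoneOn hl hc) fun x _ => hw x
  obtain ⟨q, hq, hqw⟩ := hext _ (2 * V + |φ c|) (variationOnFromTo.sub_self_monotoneOn hl hc)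
    fun x hx => by
      have h1 := abs_le.1 (hw x)
      have h2 := abs_le.1 (hφb x hx)
      have h3 := abs_le.1 (le_refl |φ c|)
      rw [Pi.sub_apply, abs_le]
      constructor <;> linarith
  refine ⟨p - q, fun x hx => ?_, ?_⟩
  · rw [Pi.sub_apply, ← hpw hx, ← hqw hx, Pi.sub_apply, sub_sub_cancel]
  · have hpq : BoundedVariationOn (p + q) (Icc a b) := by
      refine ((hp.add hq).monotoneOn _).boundedVariationOn
        (C := max |(p + q) a| |(p + q) b|) fun x hx => ?_
      exact abs_le_max_abs_abs (hp.add hq hx.1) (hp.add hq hx.2)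
    refine ne_top_of_le_ne_top hpq (iSup_mono fun u => Finset.sum_le_sum fun i _ => ?_)
    have h1 := hp (u.2.2.1 i.le_succ)
    have h2 := hq (u.2.2.1 i.le_succ)
    simp only [Nat.succ_eq_add_one] at h1 h2
    simp only [edist_dist, Real.dist_eq, Pi.add_apply, Pi.sub_apply]
    refine ENNReal.ofReal_le_ofReal ?_
    rw [abs_le, abs_of_nonneg (by linarith)]
    constructor <;> linarith

/-- For `φ ∈ L¹((a,b))`, `φ` has a representative of bounded variation on `(a,b)` iff
its subgraph has finite perimeter in `(a,b) × ℝ`. -/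
theorem stmt_2 (a b : ℝ) (hab : a < b) (φ : ℝ → ℝ)
    (hφ : IntegrableOn φ (Ioo a b)) :
    (∃ ψ : ℝ → ℝ, (∀ᵐ s ∂(volume.restrict (Ioo a b)), ψ s = φ s) ∧
        BoundedVariationOn ψ (Ioo a b)) ↔
      HasFinitePerimeterIn {q : ℝ × ℝ | q.1 ∈ Ioo a b ∧ q.2 ≤ φ q.1}
        (Ioo a b ×ˢ (univ : Set ℝ)) := by
  obtain ⟨f, hfm, hf⟩ : ∃ f : ℝ → ℝ, Measurable f ∧
      ∀ᵐ s ∂(volume.restrict (Ioo a b)), φ s = f s :=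
    ⟨_, hφ.1.stronglyMeasurable_mk.measurable, hφ.1.ae_eq_mk⟩
  rw [HasFinitePerimeterIn.congr_ae (subgraph_ae_eq hf)]
  constructor
  · rintro ⟨ψ, hψ, hbv⟩
    refine hbv.hasFinitePerimeterIn_subgraph hab hfm ?_
    filter_upwards [hψ, hf] with s h1 h2
    rw [h1, h2]
  · intro hE
    have hfi : IntegrableOn f (Ioo a b) := hφ.congr hf
    obtain ⟨C, hC⟩ := exists_integral_deriv_mul_le_of_hasFinitePerimeterIn hfm hfi hE
    obtain ⟨L, -, hL, hbv⟩ := exists_ae_eVariationOn_le_of_integral_deriv_mul_le hfi hC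
    obtain ⟨ψ, hψ, hψbv⟩ := hbv.exists_eqOn_Icc (a := a) (b := b)
    refine ⟨ψ, ?_, hψbv.mono Ioo_subset_Icc_self⟩
    filter_upwards [hL, hf] with s h1 h2
    rw [hψ h1, h2]
end

section
/- There exists a constant c > 0, depending only on the triangle T, such that every BV graph-type connection Γ = (Γ₁,Γ₂,Γ₃) in T satisfies ℋ¹(Γ_{ij}) ≤ c for all ij ∈ {12,23,31}; i.e., the lengths of the three curves of any connection are uniformly bounded. -/
open Set MeasureTheory Filter

noncomputable section

/-- The generalized graph of `φ : [0,l] → ℝ` (extended by `0` outside `[0,l]`): all points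
`(s, θ φ(s₋) + (1−θ) φ(s₊))` with `s ∈ [0,l]`, `θ ∈ [0,1]`. -/
def genGraph (φ : ℝ → ℝ) (l : ℝ) : Set (ℝ × ℝ) :=
  {q : ℝ × ℝ | ∃ s ∈ Icc (0:ℝ) l, ∃ θ ∈ Icc (0:ℝ) 1, ∃ lm rm : ℝ,
    Tendsto φ (nhdsWithin s (Iio s)) (nhds lm) ∧
    Tendsto φ (nhdsWithin s (Ioi s)) (nhds rm) ∧
    q = (s, θ * lm + (1 - θ) * rm)}

/-- The (plain) graph of `φ` over `[0,l]`. -/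
def plainGraph (φ : ℝ → ℝ) (l : ℝ) : Set (ℝ × ℝ) :=
  {q : ℝ × ℝ | ∃ s ∈ Icc (0:ℝ) l, q = (s, φ s)}

/-- Planar coordinates over the side from `a` to `b` of a triangle in `ℂ ≅ ℝ²`: `(s,t)`
is sent to the point at arclength `s` along the side, displaced by `t` in the direction
normal to the side. -/
def sideEmbed (a b : ℂ) (q : ℝ × ℝ) : ℂ :=
  a + (q.1 / ‖b - a‖) • (b - a) + (q.2 / ‖b - a‖) • (Complex.I * (b - a))

/-- A BV graph-type connection in the triangle `T ⊆ ℂ` with vertices `α₁, α₂, α₃`: three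
curves `Γᵢ ⊆ T` with `αᵢ ∈ Γᵢ`, mutually intersecting exactly at the target triple point
`p`, such that each `Γᵢ ∪ Γⱼ` is the generalized graph of a BV function
`φᵢⱼ : [0, ℓᵢⱼ] → ℝ` over the side `αᵢαⱼ` (with `ℓᵢⱼ = |αⱼ − αᵢ|`, and `φᵢⱼ` extended by
`0` outside `[0, ℓᵢⱼ]`). -/
structure BVConn (α₁ α₂ α₃ : ℂ) where
  Γ₁ : Set ℂ
  Γ₂ : Set ℂ
  Γ₃ : Set ℂ
  p : ℂ
  φ₁₂ : ℝ → ℝ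
  φ₂₃ : ℝ → ℝ
  φ₃₁ : ℝ → ℝ
  p_mem : p ∈ convexHull ℝ ({α₁, α₂, α₃} : Set ℂ)
  sub₁ : Γ₁ ⊆ convexHull ℝ ({α₁, α₂, α₃} : Set ℂ)
  sub₂ : Γ₂ ⊆ convexHull ℝ ({α₁, α₂, α₃} : Set ℂ)
  sub₃ : Γ₃ ⊆ convexHull ℝ ({α₁, α₂, α₃} : Set ℂ)
  int₁₂ : Γ₁ ∩ Γ₂ = {p}
  int₂₃ : Γ₂ ∩ Γ₃ = {p}
  int₃₁ : Γ₃ ∩ Γ₁ = {p}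
  mem₁ : α₁ ∈ Γ₁
  mem₂ : α₂ ∈ Γ₂
  mem₃ : α₃ ∈ Γ₃
  ext₁₂ : ∀ s : ℝ, s ∉ Icc (0:ℝ) ‖α₂ - α₁‖ → φ₁₂ s = 0
  ext₂₃ : ∀ s : ℝ, s ∉ Icc (0:ℝ) ‖α₃ - α₂‖ → φ₂₃ s = 0
  ext₃₁ : ∀ s : ℝ, s ∉ Icc (0:ℝ) ‖α₁ - α₃‖ → φ₃₁ s = 0
  bv₁₂ : BoundedVariationOn φ₁₂ (Icc 0 ‖α₂ - α₁‖)
  bv₂₃ : BoundedVariationOn φ₂₃ (Icc 0 ‖α₃ - α₂‖)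
  bv₃₁ : BoundedVariationOn φ₃₁ (Icc 0 ‖α₁ - α₃‖)
  graph₁₂ : Γ₁ ∪ Γ₂ = sideEmbed α₁ α₂ '' genGraph φ₁₂ ‖α₂ - α₁‖
  graph₂₃ : Γ₂ ∪ Γ₃ = sideEmbed α₂ α₃ '' genGraph φ₂₃ ‖α₃ - α₂‖
  graph₃₁ : Γ₃ ∪ Γ₁ = sideEmbed α₃ α₁ '' genGraph φ₃₁ ‖α₁ - α₃‖

/-- A connection is Lipschitz graph-type when the three functions are Lipschitz and each
`Γᵢ ∪ Γⱼ` is the plain graph of `φᵢⱼ` (no vertical parts). -/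
def BVConn.IsLip {α₁ α₂ α₃ : ℂ} (Γ : BVConn α₁ α₂ α₃) : Prop :=
  (∃ K : NNReal, LipschitzOnWith K Γ.φ₁₂ (Icc 0 ‖α₂ - α₁‖)) ∧
  (∃ K : NNReal, LipschitzOnWith K Γ.φ₂₃ (Icc 0 ‖α₃ - α₂‖)) ∧
  (∃ K : NNReal, LipschitzOnWith K Γ.φ₃₁ (Icc 0 ‖α₁ - α₃‖)) ∧
  Γ.Γ₁ ∪ Γ.Γ₂ = sideEmbed α₁ α₂ '' plainGraph Γ.φ₁₂ ‖α₂ - α₁‖ ∧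
  Γ.Γ₂ ∪ Γ.Γ₃ = sideEmbed α₂ α₃ '' plainGraph Γ.φ₂₃ ‖α₃ - α₂‖ ∧
  Γ.Γ₃ ∪ Γ.Γ₁ = sideEmbed α₃ α₁ '' plainGraph Γ.φ₃₁ ‖α₁ - α₃‖

end

open scoped NNReal ENNReal Topology

/-- Every point `y` of the connected closed set `A` splits it into two closed pieces that meet
only at `y`, the first containing `a` and lying weakly `f`-below `y`, the second containing `b`
and lying weakly `f`-above `y`. -/
structure HasMonotoneCuts {X : Type*} [TopologicalSpace X] (A : Set X) (a b : X) (f : X → ℝ) :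
    Prop where
  preconnected : IsPreconnected A
  cut : ∀ y ∈ A, ∃ U V : Set X, IsClosed U ∧ IsClosed V ∧ U ∪ V = A ∧ U ∩ V = {y} ∧
    a ∈ U ∧ b ∈ V ∧ (∀ z ∈ U, f z ≤ f y) ∧ ∀ z ∈ V, f y ≤ f z

section Cuts

variable {X : Type*} [TopologicalSpace X]

/-- If a connected set is a union of two closed sets with a single common point, the first of the
two is connected. -/
theorem IsPreconnected.left_of_union_of_inter_eq_singleton {A U V : Set X} {y : X}
    (hA : IsPreconnected A) (hU : IsClosed U) (hV : IsClosed V) (hUV : U ∪ V = A)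
    (hy : U ∩ V = {y}) : IsPreconnected U := by
  have hyU : y ∈ U := (hy.ge rfl).1
  have hyV : y ∈ V := (hy.ge rfl).2
  have key : ∀ F G : Set X, IsClosed F → IsClosed G → U ⊆ F ∪ G → y ∈ F → (U ∩ G).Nonempty →
      (U ∩ (F ∩ G)).Nonempty := by
    intro F G hF hG hFG hyF ⟨w, hwU, hwG⟩
    rw [isPreconnected_closed_iff] at hA
    obtain ⟨z, -, hz1, hz2⟩ := hA (F ∩ U ∪ V) (G ∩ U) ((hF.inter hU).union hV) (hG.inter hU)
      (by
        intro z hz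
        rw [← hUV] at hz
        rcases hz with hz | hz
        · rcases hFG hz with h | h
          · exact Or.inl (Or.inl ⟨h, hz⟩)
          · exact Or.inr ⟨h, hz⟩
        · exact Or.inl (Or.inr hz))
      ⟨y, hUV ▸ Or.inl hyU, Or.inr hyV⟩ ⟨w, hUV ▸ Or.inl hwU, hwG, hwU⟩
    rcases hz1 with hz1 | hz1
    · exact ⟨z, hz2.2, hz1.1, hz2.1⟩
    · obtain rfl : z = y := hy.le ⟨hz2.2, hz1⟩
      exact ⟨z, hyU, hyF, hz2.1⟩
  rw [isPreconnected_closed_iff]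
  intro F G hF hG hFG hneF hneG
  rcases hFG hyU with h | h
  · exact key F G hF hG hFG h hneG
  · rw [inter_comm F G]
    exact key G F hG hF (by rwa [union_comm]) h hneF

theorem IsPreconnected.right_of_union_of_inter_eq_singleton {A U V : Set X} {y : X}
    (hA : IsPreconnected A) (hU : IsClosed U) (hV : IsClosed V) (hUV : U ∪ V = A)
    (hy : U ∩ V = {y}) : IsPreconnected V :=
  hA.left_of_union_of_inter_eq_singleton hV hU (by rwa [union_comm]) (by rwa [inter_comm])

/-- A connected set joining the two sides of a closed cut contains the cut point. -/
theorem IsPreconnected.mem_of_cut {W U V : Set X} {x u v : X} (hW : IsPreconnected W)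
    (hU : IsClosed U) (hV : IsClosed V) (hWUV : W ⊆ U ∪ V) (hx : U ∩ V = {x})
    (hu : u ∈ W) (huU : u ∈ U) (hv : v ∈ W) (hvV : v ∈ V) : x ∈ W := by
  rw [isPreconnected_closed_iff] at hW
  obtain ⟨z, hz, hz'⟩ := hW U V hU hV hWUV ⟨u, hu, huU⟩ ⟨v, hv, hvV⟩
  obtain rfl : z = x := hx.le hz'
  exact hz

theorem HasMonotoneCuts.symm {A : Set X} {a b : X} {f : X → ℝ} (h : HasMonotoneCuts A a b f) :
    HasMonotoneCuts A b a (fun z => -f z) := by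
  refine ⟨h.preconnected, fun y hy => ?_⟩
  obtain ⟨U, V, hU, hV, hUV, hy', ha, hb, h1, h2⟩ := h.cut y hy
  exact ⟨V, U, hV, hU, by rwa [union_comm], by rwa [inter_comm], hb, ha,
    fun z hz => neg_le_neg (h2 z hz), fun z hz => neg_le_neg (h1 z hz)⟩

theorem HasMonotoneCuts.isClosed {A : Set X} {a b : X} {f : X → ℝ}
    (h : HasMonotoneCuts A a b f) : IsClosed A := by
  rcases A.eq_empty_or_nonempty with rfl | ⟨y, hy⟩
  · exact isClosed_empty
  · obtain ⟨U, V, hU, hV, hUV, -⟩ := h.cut y hy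
    exact hUV ▸ hU.union hV

theorem HasMonotoneCuts.image {Y : Type*} [TopologicalSpace Y] {A : Set X} {a b : X} {f : X → ℝ}
    (h : HasMonotoneCuts A a b f) {e : X → Y} (he : Topology.IsClosedEmbedding e) {g : Y → ℝ}
    (hg : ∀ x y, f x ≤ f y → g (e x) ≤ g (e y)) :
    HasMonotoneCuts (e '' A) (e a) (e b) g := by
  refine ⟨h.preconnected.image e he.continuous.continuousOn, ?_⟩
  rintro _ ⟨y, hy, rfl⟩
  obtain ⟨U, V, hU, hV, hUV, hy', ha, hb, h1, h2⟩ := h.cut y hy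
  refine ⟨e '' U, e '' V, he.isClosedMap U hU, he.isClosedMap V hV, by rw [← image_union, hUV],
    by rw [← image_inter he.injective, hy', image_singleton], mem_image_of_mem e ha,
    mem_image_of_mem e hb, ?_, ?_⟩
  · rintro _ ⟨z, hz, rfl⟩
    exact hg _ _ (h1 z hz)
  · rintro _ ⟨z, hz, rfl⟩
    exact hg _ _ (h2 z hz)

/-- If `A = S ∪ S'` with `S ∩ S' = {p}` runs from `a ∈ S` to `b ∈ S'`, then `p` lies after every
point of `S`. -/
theorem HasMonotoneCuts.mem_after {A S S' U V : Set X} {a b p x : X} {f : X → ℝ}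
    (h : HasMonotoneCuts A a b f) (hS : IsClosed S) (hS' : IsClosed S') (hA : S ∪ S' = A)
    (hp : S ∩ S' = {p}) (hb : b ∈ S') (hx : x ∈ S) (hU : IsClosed U) (hV : IsClosed V)
    (hUV : U ∪ V = A) (hxUV : U ∩ V = {x}) (hbV : b ∈ V) : p ∈ V :=
  (h.preconnected.right_of_union_of_inter_eq_singleton hU hV hUV hxUV).mem_of_cut hS hS'
    (by rw [hA, ← hUV]; exact subset_union_right) hp (hxUV.ge rfl).2 hx hbV hb

/-- Two branches with a common stem `S` from `a` to `p`, cut at the same point `y ∈ S`: any point of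
`S` lies before `y` on the first branch or after `y` on the second. -/
theorem HasMonotoneCuts.mem_before_or_after {A C S S₂ S₃ U V U' V' : Set X} {a b c p x y : X}
    {f g : X → ℝ} (hA : HasMonotoneCuts A a b f) (hC : HasMonotoneCuts C a c g)
    (hS : IsClosed S) (hS₂ : IsClosed S₂) (hS₃ : IsClosed S₃)
    (hSA : S ∪ S₂ = A) (hSC : S ∪ S₃ = C) (hp₂ : S ∩ S₂ = {p}) (hp₃ : S ∩ S₃ = {p})
    (hb : b ∈ S₂) (hc : c ∈ S₃) (hx : x ∈ S) (hy : y ∈ S)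
    (hU : IsClosed U) (hV : IsClosed V) (hUV : U ∪ V = A) (hyUV : U ∩ V = {y}) (haU : a ∈ U)
    (hU' : IsClosed U') (hV' : IsClosed V') (hUV' : U' ∪ V' = C) (hyUV' : U' ∩ V' = {y})
    (hcV' : c ∈ V') : x ∈ U ∨ x ∈ V' := by
  have hSsubA : S ⊆ A := hSA ▸ subset_union_left
  obtain ⟨P, Q, hP, hQ, hPQ, hxPQ, haP, hbQ, -, -⟩ := hA.cut x (hSsubA hx)
  have hpQ : p ∈ Q := hA.mem_after hS hS₂ hSA hp₂ hb hx hP hQ hPQ hxPQ hbQ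
  have hpV' : p ∈ V' := hC.mem_after hS hS₃ hSC hp₃ hc hy hU' hV' hUV' hyUV' hcV'
  have hUc : IsPreconnected U :=
    hA.preconnected.left_of_union_of_inter_eq_singleton hU hV hUV hyUV
  have hV'c : IsPreconnected V' :=
    hC.preconnected.right_of_union_of_inter_eq_singleton hU' hV' hUV' hyUV'
  have hWc : IsPreconnected (V' ∩ S) := by
    refine hV'c.left_of_union_of_inter_eq_singleton (V := V' ∩ S₃) (y := p)
      (hV'.inter hS) (hV'.inter hS₃) ?_ ?_
    · rw [← inter_union_distrib_left, hSC, ← hUV']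
      exact inter_eq_left.2 subset_union_right
    · rw [← inter_inter_distrib_left, hp₃]
      exact inter_eq_right.2 (singleton_subset_iff.2 hpV')
  have hpS : p ∈ S := (hp₂.ge rfl).1
  have hyW : y ∈ V' ∩ S := ⟨(hyUV'.ge rfl).2, hy⟩
  have hmem := (hUc.union y (hyUV.ge rfl).1 hyW hWc).mem_of_cut hP hQ
    (by
      rw [hPQ]
      exact union_subset (hUV ▸ subset_union_left) (inter_subset_right.trans hSsubA))
    hxPQ (Or.inl haU) haP (Or.inr ⟨hpV', hpS⟩) hpQ
  exact hmem.imp_right And.left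

/-- On a common stem `S` of two connected sets with monotone cuts, issuing from the same
endpoint `a` and ending at the same branch point `p`, the two height functions are comonotone. -/
theorem HasMonotoneCuts.comonotone {A C S S₂ S₃ : Set X} {a b c p : X} {f g : X → ℝ}
    (hA : HasMonotoneCuts A a b f) (hC : HasMonotoneCuts C a c g)
    (hS : IsClosed S) (hS₂ : IsClosed S₂) (hS₃ : IsClosed S₃)
    (hSA : S ∪ S₂ = A) (hSC : S ∪ S₃ = C) (hp₂ : S ∩ S₂ = {p}) (hp₃ : S ∩ S₃ = {p})
    (hb : b ∈ S₂) (hc : c ∈ S₃) {x y : X} (hx : x ∈ S) (hy : y ∈ S) :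
    (f x ≤ f y ∧ g x ≤ g y) ∨ (f y ≤ f x ∧ g y ≤ g x) := by
  have hyA : y ∈ A := hSA ▸ Or.inl hy
  have hyC : y ∈ C := hSC ▸ Or.inl hy
  obtain ⟨U, V, hU, hV, hUV, hyUV, haU, hbV, hf1, hf2⟩ := hA.cut y hyA
  obtain ⟨U', V', hU', hV', hUV', hyUV', haU', hcV', hg1, hg2⟩ := hC.cut y hyC
  have h1 : x ∈ U ∨ x ∈ V' := hA.mem_before_or_after hC hS hS₂ hS₃ hSA hSC hp₂ hp₃ hb hc hx hy
    hU hV hUV hyUV haU hU' hV' hUV' hyUV' hcV'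
  have h2 : x ∈ U' ∨ x ∈ V := hC.mem_before_or_after hA hS hS₃ hS₂ hSC hSA hp₃ hp₂ hc hb hx hy
    hU' hV' hUV' hyUV' haU' hU hV hUV hyUV hbV
  have hxA : x ∈ U ∪ V := by rw [hUV, ← hSA]; exact Or.inl hx
  by_cases hxU : x ∈ U
  · rcases h2 with hxU' | hxV
    · exact Or.inl ⟨hf1 x hxU, hg1 x hxU'⟩
    · obtain rfl : x = y := hyUV.le ⟨hxU, hxV⟩
      exact Or.inl ⟨le_rfl, le_rfl⟩
  · exact Or.inr ⟨hf2 x (hxA.resolve_left hxU), hg2 x (h1.resolve_left hxU)⟩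

end Cuts

section GenGraph

/-- A function of bounded variation on `[0,l]` that vanishes outside has left limits everywhere. -/
theorem BoundedVariationOn.exists_tendsto_Iio_of_eq_zero {φ : ℝ → ℝ} {l : ℝ}
    (hφ : BoundedVariationOn φ (Icc 0 l)) (h0 : ∀ s ∉ Icc (0 : ℝ) l, φ s = 0) (s : ℝ) :
    ∃ y, Tendsto φ (𝓝[<] s) (𝓝 y) := by
  by_cases hs : s ∈ Ioc 0 l
  · obtain ⟨y, hy⟩ := hφ.exists_tendsto_left s
    refine ⟨y, hy.mono_left ?_⟩
    rw [nhdsWithin_le_iff]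
    filter_upwards [Ioo_mem_nhdsLT hs.1] with r hr
    exact ⟨⟨hr.1.le, hr.2.le.trans hs.2⟩, hr.2⟩
  · refine ⟨0, tendsto_const_nhds.congr' ?_⟩
    rcases le_or_gt s 0 with h | h
    · filter_upwards [self_mem_nhdsWithin] with r hr
      exact (h0 r fun hr' => absurd hr'.1 (not_le.2 (lt_of_lt_of_le hr h))).symm
    · have hl : l < s := by
        by_contra! hle
        exact hs ⟨h, hle⟩
      filter_upwards [Ioo_mem_nhdsLT hl] with r hr
      exact (h0 r fun hr' => absurd hr'.2 (not_le.2 hr.1)).symm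

/-- A function of bounded variation on `[0,l]` that vanishes outside has right limits
everywhere. -/
theorem BoundedVariationOn.exists_tendsto_Ioi_of_eq_zero {φ : ℝ → ℝ} {l : ℝ}
    (hφ : BoundedVariationOn φ (Icc 0 l)) (h0 : ∀ s ∉ Icc (0 : ℝ) l, φ s = 0) (s : ℝ) :
    ∃ y, Tendsto φ (𝓝[>] s) (𝓝 y) := by
  by_cases hs : s ∈ Ico 0 l
  · obtain ⟨y, hy⟩ := hφ.exists_tendsto_right s
    refine ⟨y, hy.mono_left ?_⟩
    rw [nhdsWithin_le_iff]
    filter_upwards [Ioo_mem_nhdsGT hs.2] with r hr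
    exact ⟨⟨hs.1.trans hr.1.le, hr.2.le⟩, hr.1⟩
  · refine ⟨0, tendsto_const_nhds.congr' ?_⟩
    rcases le_or_gt l s with h | h
    · filter_upwards [self_mem_nhdsWithin] with r hr
      exact (h0 r fun hr' => absurd hr'.2 (not_le.2 (lt_of_le_of_lt h hr))).symm
    · have hl : s < 0 := by
        by_contra! hle
        exact hs ⟨hle, h⟩
      filter_upwards [Ioo_mem_nhdsGT hl] with r hr
      exact (h0 r fun hr' => absurd hr'.1 (not_le.2 hr.2)).symm

variable {φ L R : ℝ → ℝ}

/-- The generalized graph in terms of the one-sided limit functions. -/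
theorem genGraph_eq_of_tendsto (hL : ∀ s, Tendsto φ (𝓝[<] s) (𝓝 (L s)))
    (hR : ∀ s, Tendsto φ (𝓝[>] s) (𝓝 (R s))) (l : ℝ) :
    genGraph φ l = {q | q.1 ∈ Icc 0 l ∧ q.2 ∈ uIcc (L q.1) (R q.1)} := by
  ext ⟨s, t⟩
  simp only [genGraph, mem_ofPred_eq, Prod.mk.injEq]
  constructor
  · rintro ⟨s', hs, θ, hθ, lm, rm, hlm, hrm, rfl, rfl⟩
    obtain rfl := tendsto_nhds_unique hlm (hL s)
    obtain rfl := tendsto_nhds_unique hrm (hR s)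
    refine ⟨hs, ?_⟩
    rw [← segment_eq_uIcc]
    exact ⟨θ, 1 - θ, hθ.1, sub_nonneg.2 hθ.2, by ring, rfl⟩
  · rintro ⟨hs, ht⟩
    rw [← segment_eq_uIcc] at ht
    obtain ⟨θ, θ', hθ, hθ', hsum, rfl⟩ := ht
    obtain rfl : θ' = 1 - θ := by linarith
    exact ⟨s, hs, θ, ⟨hθ, sub_nonneg.1 hθ'⟩, L s, R s, hL s, hR s, rfl, rfl⟩

theorem uIcc_oneSidedLim_subset_of_eventually {K : Set ℝ} (hK : IsClosed K) (hKc : K.OrdConnected)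
    {r : ℝ} (hL : Tendsto φ (𝓝[<] r) (𝓝 (L r))) (hR : Tendsto φ (𝓝[>] r) (𝓝 (R r)))
    (h : ∀ᶠ s in 𝓝 r, φ s ∈ K) : uIcc (L r) (R r) ⊆ K :=
  hKc.uIcc_subset (hK.mem_of_tendsto hL (h.filter_mono nhdsWithin_le_nhds))
    (hK.mem_of_tendsto hR (h.filter_mono nhdsWithin_le_nhds))

/-- Limits of points of the full generalized graph approached from the left. -/
theorem snd_eq_of_mem_closure_left (hL : ∀ s, Tendsto φ (𝓝[<] s) (𝓝 (L s)))
    (hR : ∀ s, Tendsto φ (𝓝[>] s) (𝓝 (R s))) {z : ℝ × ℝ}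
    (hz : z ∈ closure {q : ℝ × ℝ | q.1 < z.1 ∧ q.2 ∈ uIcc (L q.1) (R q.1)}) : z.2 = L z.1 := by
  refine eq_of_forall_dist_le fun ε hε => ?_
  have hK := (hL z.1).eventually (Metric.closedBall_mem_nhds (L z.1) hε)
  obtain ⟨δ, hδ, hδK⟩ := (mem_nhdsLT_iff_exists_Ioo_subset).1 hK
  have hfreq := mem_closure_iff_frequently.1 hz
  have hev : ∀ᶠ q in 𝓝 z, δ < q.1 := (continuous_fst.tendsto z).eventually (lt_mem_nhds hδ)
  refine (Metric.isClosed_closedBall (x := L z.1) (ε := ε)).mem_of_frequently_of_tendsto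
    ((hfreq.and_eventually hev).mono ?_) (continuous_snd.tendsto z)
  rintro q ⟨⟨hq1, hq2⟩, hq3⟩
  refine uIcc_oneSidedLim_subset_of_eventually Metric.isClosed_closedBall ?_ (hL q.1) (hR q.1) ?_
    hq2
  · rw [Real.closedBall_eq_Icc]
    exact ordConnected_Icc
  · filter_upwards [Ioo_mem_nhds hq3 hq1] with s hs using hδK hs

/-- Limits of points of the full generalized graph approached from the right. -/
theorem snd_eq_of_mem_closure_right (hL : ∀ s, Tendsto φ (𝓝[<] s) (𝓝 (L s)))
    (hR : ∀ s, Tendsto φ (𝓝[>] s) (𝓝 (R s))) {z : ℝ × ℝ}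
    (hz : z ∈ closure {q : ℝ × ℝ | z.1 < q.1 ∧ q.2 ∈ uIcc (L q.1) (R q.1)}) : z.2 = R z.1 := by
  refine eq_of_forall_dist_le fun ε hε => ?_
  have hK := (hR z.1).eventually (Metric.closedBall_mem_nhds (R z.1) hε)
  obtain ⟨δ, hδ, hδK⟩ := (mem_nhdsGT_iff_exists_Ioo_subset).1 hK
  have hfreq := mem_closure_iff_frequently.1 hz
  have hev : ∀ᶠ q in 𝓝 z, q.1 < δ := (continuous_fst.tendsto z).eventually (gt_mem_nhds hδ)
  refine (Metric.isClosed_closedBall (x := R z.1) (ε := ε)).mem_of_frequently_of_tendsto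
    ((hfreq.and_eventually hev).mono ?_) (continuous_snd.tendsto z)
  rintro q ⟨⟨hq1, hq2⟩, hq3⟩
  refine uIcc_oneSidedLim_subset_of_eventually Metric.isClosed_closedBall ?_ (hL q.1) (hR q.1) ?_
    hq2
  · rw [Real.closedBall_eq_Icc]
    exact ordConnected_Icc
  · filter_upwards [Ioo_mem_nhds hq1 hq3] with s hs using hδK hs

/-- Closedness of pieces of a generalized graph: the fibre over `s` may be shrunk to a closed
subset `Φ s` as long as it keeps the one-sided limits along which it can be approached. -/
theorem isClosed_graphPiece (hL : ∀ s, Tendsto φ (𝓝[<] s) (𝓝 (L s)))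
    (hR : ∀ s, Tendsto φ (𝓝[>] s) (𝓝 (R s))) {a b : ℝ} {Φ : ℝ → Set ℝ}
    (hΦ : ∀ s, IsClosed (Φ s)) (hsub : ∀ s ∈ Icc a b, Φ s ⊆ uIcc (L s) (R s))
    (hΦL : ∀ s ∈ Ioc a b, L s ∈ Φ s) (hΦR : ∀ s ∈ Ico a b, R s ∈ Φ s) :
    IsClosed {q : ℝ × ℝ | q.1 ∈ Icc a b ∧ q.2 ∈ Φ q.1} := by
  rw [← closure_subset_iff_isClosed]
  intro z hz
  set S := {q : ℝ × ℝ | q.1 ∈ Icc a b ∧ q.2 ∈ Φ q.1} with hS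
  have hzI : z.1 ∈ Icc a b :=
    closure_minimal (fun q hq => hq.1) (isClosed_Icc.preimage continuous_fst) hz
  have hsplit : S ⊆ (S ∩ {q | q.1 < z.1}) ∪ (S ∩ {q | q.1 = z.1}) ∪ (S ∩ {q | z.1 < q.1}) := by
    intro q hq
    rcases lt_trichotomy q.1 z.1 with h | h | h
    · exact Or.inl (Or.inl ⟨hq, h⟩)
    · exact Or.inl (Or.inr ⟨hq, h⟩)
    · exact Or.inr ⟨hq, h⟩
  have hz' := closure_mono hsplit hz
  rw [closure_union, closure_union] at hz'
  refine ⟨hzI, ?_⟩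
  rcases hz' with (h | h) | h
  · obtain ⟨q, hq, hqz⟩ := closure_nonempty_iff.1 ⟨z, h⟩
    have hlim : z.2 = L z.1 := snd_eq_of_mem_closure_left hL hR
      (closure_mono (fun r hr => And.intro hr.2 (hsub _ hr.1.1 hr.1.2)) h)
    rw [hlim]
    exact hΦL _ ⟨lt_of_le_of_lt hq.1.1 hqz, hzI.2⟩
  · refine closure_minimal (t := Prod.snd ⁻¹' Φ z.1) ?_ ((hΦ z.1).preimage continuous_snd) h
    rintro q ⟨hq, hqz⟩
    have hqz : q.1 = z.1 := hqz
    exact hqz ▸ hq.2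
  · obtain ⟨q, hq, hqz⟩ := closure_nonempty_iff.1 ⟨z, h⟩
    have hlim : z.2 = R z.1 := snd_eq_of_mem_closure_right hL hR
      (closure_mono (fun r hr => And.intro hr.2 (hsub _ hr.1.1 hr.1.2)) h)
    rw [hlim]
    exact hΦR _ ⟨hzI.1, lt_of_lt_of_le hqz hq.1.2⟩

/-- The generalized graph of a bounded function with one-sided limits is connected. -/
theorem isPreconnected_graph (hL : ∀ s, Tendsto φ (𝓝[<] s) (𝓝 (L s)))
    (hR : ∀ s, Tendsto φ (𝓝[>] s) (𝓝 (R s))) {M : ℝ} (hM : ∀ s, φ s ∈ Icc (-M) M) (l : ℝ) :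
    IsPreconnected {q : ℝ × ℝ | q.1 ∈ Icc 0 l ∧ q.2 ∈ uIcc (L q.1) (R q.1)} := by
  set G := {q : ℝ × ℝ | q.1 ∈ Icc 0 l ∧ q.2 ∈ uIcc (L q.1) (R q.1)} with hG
  have hGclosed : IsClosed G :=
    isClosed_graphPiece (Φ := fun s => uIcc (L s) (R s)) hL hR (fun s => isClosed_Icc)
      (fun s _ => le_rfl) (fun s _ => left_mem_uIcc) fun s _ => right_mem_uIcc
  have hGc : IsCompact G := by
    refine (isCompact_Icc.prod isCompact_Icc).of_isClosed_subset hGclosed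
      (s := Icc 0 l ×ˢ Icc (-M) M) ?_
    rintro q ⟨hq1, hq2⟩
    exact ⟨hq1, uIcc_oneSidedLim_subset_of_eventually isClosed_Icc ordConnected_Icc
      (hL q.1) (hR q.1) (Eventually.of_forall hM) hq2⟩
  rw [isPreconnected_closed_iff]
  rintro F H hF hH hFH ⟨q, hqG, hqF⟩ ⟨q', hqG', hqH⟩
  have hproj : ∀ K : Set (ℝ × ℝ), IsClosed K → IsClosed (Prod.fst '' (G ∩ K)) := fun K hK =>
    ((hGc.inter_right hK).image continuous_fst).isClosed
  obtain ⟨s, hs, ⟨u, ⟨huG, huF⟩, hu⟩, ⟨v, ⟨hvG, hvH⟩, hv⟩⟩ :=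
    isPreconnected_closed_iff.1 (isPreconnected_Icc (a := (0 : ℝ)) (b := l)) _ _
      (hproj F hF) (hproj H hH)
      (by
        intro s hs
        have hsG : (s, L s) ∈ G := ⟨hs, left_mem_uIcc⟩
        exact (hFH hsG).imp (fun h => ⟨_, ⟨hsG, h⟩, rfl⟩) fun h => ⟨_, ⟨hsG, h⟩, rfl⟩)
      ⟨q.1, hqG.1, q, ⟨hqG, hqF⟩, rfl⟩ ⟨q'.1, hqG'.1, q', ⟨hqG', hqH⟩, rfl⟩
  have hfib : IsPreconnected (Prod.mk s '' uIcc (L s) (R s)) :=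
    isPreconnected_uIcc.image _ (by fun_prop)
  have hfibG : Prod.mk s '' uIcc (L s) (R s) ⊆ G := by
    rintro _ ⟨t, ht, rfl⟩
    exact ⟨hs, ht⟩
  obtain ⟨w, hw, hwFH⟩ := isPreconnected_closed_iff.1 hfib F H hF hH (hfibG.trans hFH)
    ⟨u, ⟨u.2, hu ▸ huG.2, by rw [← hu]⟩, huF⟩ ⟨v, ⟨v.2, hv ▸ hvG.2, by rw [← hv]⟩, hvH⟩
  exact ⟨w, hfibG hw, hwFH⟩

/-- The generalized graph over `[0,l]` of a bounded function vanishing outside `[0,l]` has cuts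
that are monotone in the first coordinate. -/
theorem hasMonotoneCuts_graph (hL : ∀ s, Tendsto φ (𝓝[<] s) (𝓝 (L s)))
    (hR : ∀ s, Tendsto φ (𝓝[>] s) (𝓝 (R s))) {M : ℝ} (hM : ∀ s, φ s ∈ Icc (-M) M) {l : ℝ}
    (hL0 : L 0 = 0) (hRl : R l = 0) :
    HasMonotoneCuts {q : ℝ × ℝ | q.1 ∈ Icc 0 l ∧ q.2 ∈ uIcc (L q.1) (R q.1)} (0, 0) (l, 0)
      Prod.fst := by
  refine ⟨isPreconnected_graph hL hR hM l, ?_⟩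
  rintro ⟨s, t⟩ ⟨⟨hs0, hsl⟩, ht⟩
  dsimp only at hs0 hsl ht
  let Φ : ℝ → Set ℝ := fun r => uIcc (L r) (if r = s then t else R r)
  let Ψ : ℝ → Set ℝ := fun r => uIcc (if r = s then t else L r) (R r)
  have hΦsub : ∀ r, Φ r ⊆ uIcc (L r) (R r) := by
    intro r
    by_cases hr : r = s
    · subst hr
      simpa [Φ] using uIcc_subset_uIcc left_mem_uIcc ht
    · simp [Φ, hr]
  have hΨsub : ∀ r, Ψ r ⊆ uIcc (L r) (R r) := by
    intro r
    by_cases hr : r = s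
    · subst hr
      simpa [Ψ] using uIcc_subset_uIcc ht right_mem_uIcc
    · simp [Ψ, hr]
  refine ⟨{q | q.1 ∈ Icc 0 s ∧ q.2 ∈ Φ q.1}, {q | q.1 ∈ Icc s l ∧ q.2 ∈ Ψ q.1},
    isClosed_graphPiece hL hR (fun r => isClosed_Icc) (fun r _ => hΦsub r)
      (fun r _ => left_mem_uIcc) (fun r hr => ?_),
    isClosed_graphPiece hL hR (fun r => isClosed_Icc) (fun r _ => hΨsub r)
      (fun r hr => ?_) (fun r _ => right_mem_uIcc), ?_, ?_, ?_, ?_, ?_, ?_⟩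
  · simp [Φ, hr.2.ne]
  · simp [Ψ, hr.1.ne']
  · ext ⟨r, w⟩
    simp only [mem_union, mem_ofPred_eq]
    constructor
    · rintro (⟨hr, hw⟩ | ⟨hr, hw⟩)
      · exact ⟨⟨hr.1, hr.2.trans hsl⟩, hΦsub r hw⟩
      · exact ⟨⟨hs0.trans hr.1, hr.2⟩, hΨsub r hw⟩
    · rintro ⟨hr, hw⟩
      rcases lt_trichotomy r s with h | rfl | h
      · exact Or.inl ⟨⟨hr.1, h.le⟩, by simpa [Φ, h.ne] using hw⟩
      · rcases uIcc_subset_uIcc_union_uIcc (b := t) hw with h | h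
        · exact Or.inl ⟨⟨hr.1, le_rfl⟩, by simpa [Φ] using h⟩
        · exact Or.inr ⟨⟨le_rfl, hr.2⟩, by simpa [Ψ] using h⟩
      · exact Or.inr ⟨⟨h.le, hr.2⟩, by simpa [Ψ, h.ne'] using hw⟩
  · refine Subset.antisymm ?_ ?_
    · rintro ⟨r, w⟩ ⟨⟨hr, hw⟩, ⟨hr', hw'⟩⟩
      obtain rfl : r = s := le_antisymm hr.2 hr'.1
      have hw : w ∈ uIcc (L r) t := by simpa [Φ] using hw
      have hw' : w ∈ uIcc t (R r) := by simpa [Ψ] using hw'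
      have hwt : w = t := by
        rw [mem_uIcc] at hw hw' ht
        rcases hw with hw | hw <;> rcases hw' with hw' | hw' <;> rcases ht with ht | ht <;> linarith
      rw [hwt]
      rfl
    · rintro _ rfl
      exact ⟨⟨⟨hs0, le_rfl⟩, by simp [Φ]⟩, ⟨⟨le_rfl, hsl⟩, by simp [Ψ]⟩⟩
  · exact ⟨⟨le_rfl, hs0⟩, by
      have h : L 0 ∈ Φ 0 := left_mem_uIcc
      rw [hL0] at h
      exact h⟩
  · exact ⟨⟨hsl, le_rfl⟩, by
      have h : R l ∈ Ψ l := right_mem_uIcc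
      rw [hRl] at h
      exact h⟩
  · exact fun q hq => hq.1.2
  · exact fun q hq => hq.1.1

/-- The generalized graph of a function of bounded variation vanishing outside `[0,l]` has cuts
that are monotone in the first coordinate. -/
theorem hasMonotoneCuts_genGraph {l : ℝ} (hl : 0 ≤ l) (hφ : BoundedVariationOn φ (Icc 0 l))
    (h0 : ∀ s ∉ Icc (0 : ℝ) l, φ s = 0) :
    HasMonotoneCuts (genGraph φ l) (0, 0) (l, 0) Prod.fst := by
  choose L hL using hφ.exists_tendsto_Iio_of_eq_zero h0
  choose R hR using hφ.exists_tendsto_Ioi_of_eq_zero h0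
  rw [genGraph_eq_of_tendsto hL hR]
  have hM : ∀ s, φ s ∈ Icc (-(|φ 0| + (eVariationOn φ (Icc 0 l)).toReal))
      (|φ 0| + (eVariationOn φ (Icc 0 l)).toReal) := by
    intro s
    rw [mem_Icc, ← abs_le]
    by_cases hs : s ∈ Icc 0 l
    · have := hφ.dist_le hs (left_mem_Icc.2 hl)
      rw [Real.dist_eq] at this
      have h2 := abs_sub_abs_le_abs_sub (φ s) (φ 0)
      linarith
    · rw [h0 s hs, abs_zero]
      positivity
  refine hasMonotoneCuts_graph hL hR hM ?_ ?_
  · refine tendsto_nhds_unique (hL 0) (tendsto_const_nhds.congr' ?_)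
    filter_upwards [self_mem_nhdsWithin] with r hr
    exact (h0 r fun h => absurd h.1 (not_le.2 hr)).symm
  · refine tendsto_nhds_unique (hR l) (tendsto_const_nhds.congr' ?_)
    filter_upwards [self_mem_nhdsWithin] with r hr
    exact (h0 r fun h => absurd h.2 (not_le.2 hr)).symm

end GenGraph

/-- The component of `z` along `d`, scaled by `‖d‖`. -/
def alongSide (d z : ℂ) : ℝ := (z * (starRingEnd ℂ) d).re

theorem continuous_alongSide (d : ℂ) : Continuous (alongSide d) := by
  unfold alongSide
  fun_prop

theorem alongSide_sub (d z w : ℂ) : alongSide d (z - w) = alongSide d z - alongSide d w := by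
  simp [alongSide, sub_mul]

theorem alongSide_neg (d z : ℂ) : alongSide (-d) z = -alongSide d z := by
  simp only [alongSide, map_neg, mul_neg, Complex.neg_re]

theorem alongSide_sideEmbed {a b : ℂ} (hab : a ≠ b) (q : ℝ × ℝ) :
    alongSide (b - a) (sideEmbed a b q) = alongSide (b - a) a + q.1 * ‖b - a‖ := by
  have hd : ‖b - a‖ ≠ 0 := norm_ne_zero_iff.2 (sub_ne_zero.2 hab.symm)
  have hsq : ‖b - a‖ ^ 2 = (b - a).re ^ 2 + (b - a).im ^ 2 := by
    rw [← Complex.normSq_eq_norm_sq, Complex.normSq_apply]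
    ring
  unfold sideEmbed alongSide
  generalize b - a = d at *
  simp only [Complex.mul_re, Complex.add_re, Complex.add_im, Complex.conj_re, Complex.conj_im,
    Complex.real_smul, Complex.ofReal_re, Complex.ofReal_im, Complex.mul_im, Complex.I_re,
    Complex.I_im]
  field_simp
  linear_combination (-q.1) * hsq

theorem alongSide_I_mul_sideEmbed {a b : ℂ} (hab : a ≠ b) (q : ℝ × ℝ) :
    alongSide (Complex.I * (b - a)) (sideEmbed a b q) =
      alongSide (Complex.I * (b - a)) a + q.2 * ‖b - a‖ := by
  have hd : ‖b - a‖ ≠ 0 := norm_ne_zero_iff.2 (sub_ne_zero.2 hab.symm)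
  have hsq : ‖b - a‖ ^ 2 = (b - a).re ^ 2 + (b - a).im ^ 2 := by
    rw [← Complex.normSq_eq_norm_sq, Complex.normSq_apply]
    ring
  unfold sideEmbed alongSide
  generalize b - a = d at *
  simp only [Complex.mul_re, Complex.add_re, Complex.add_im, Complex.conj_re, Complex.conj_im,
    Complex.real_smul, Complex.ofReal_re, Complex.ofReal_im, Complex.mul_im, Complex.I_re,
    Complex.I_im]
  field_simp
  linear_combination (-q.2) * hsq

theorem isClosedEmbedding_sideEmbed {a b : ℂ} (hab : a ≠ b) :
    Topology.IsClosedEmbedding (sideEmbed a b) := by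
  have hd : ‖b - a‖ ≠ 0 := norm_ne_zero_iff.2 (sub_ne_zero.2 hab.symm)
  refine Function.LeftInverse.isClosedEmbedding
    (f := fun z => ((alongSide (b - a) z - alongSide (b - a) a) / ‖b - a‖,
      (alongSide (Complex.I * (b - a)) z - alongSide (Complex.I * (b - a)) a) / ‖b - a‖))
    (fun q => ?_) ?_ ?_
  · simp only [alongSide_sideEmbed hab, alongSide_I_mul_sideEmbed hab, add_sub_cancel_left,
      mul_div_cancel_right₀ _ hd]
  · have h1 := continuous_alongSide (b - a)
    have h2 := continuous_alongSide (Complex.I * (b - a))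
    fun_prop
  · unfold sideEmbed
    fun_prop

theorem hasMonotoneCuts_side {a b : ℂ} (hab : a ≠ b) {φ : ℝ → ℝ}
    (hφ : BoundedVariationOn φ (Icc 0 ‖b - a‖)) (h0 : ∀ s ∉ Icc (0 : ℝ) ‖b - a‖, φ s = 0) :
    HasMonotoneCuts (sideEmbed a b '' genGraph φ ‖b - a‖) a b (alongSide (b - a)) := by
  have hd : (‖b - a‖ : ℂ) ≠ 0 := by simpa using sub_ne_zero.2 hab.symm
  have h := (hasMonotoneCuts_genGraph (norm_nonneg (b - a)) hφ h0).image
    (isClosedEmbedding_sideEmbed hab) (g := alongSide (b - a)) (fun x y hxy => by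
      rw [alongSide_sideEmbed hab, alongSide_sideEmbed hab]
      gcongr)
  have ha : sideEmbed a b (0, 0) = a := by simp [sideEmbed]
  have hb : sideEmbed a b (‖b - a‖, 0) = b := by simp [sideEmbed, hd]
  rwa [ha, hb] at h

/-- A vector of the plane is controlled by its components along two independent directions. -/
theorem norm_mul_abs_im_le (d e w : ℂ) :
    ‖w‖ * |((starRingEnd ℂ) d * e).im| ≤ |alongSide d w| * ‖e‖ + |alongSide e w| * ‖d‖ := by
  have h : w * (Complex.I * (((starRingEnd ℂ) d * e).im : ℝ)) =
      (alongSide d w : ℂ) * e - (alongSide e w : ℂ) * d := by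
    apply Complex.ext <;> simp [alongSide] <;> ring
  calc ‖w‖ * |((starRingEnd ℂ) d * e).im|
      = ‖w * (Complex.I * (((starRingEnd ℂ) d * e).im : ℝ))‖ := by
        rw [norm_mul, norm_mul, Complex.norm_I, one_mul, Complex.norm_real, Real.norm_eq_abs]
    _ ≤ ‖(alongSide d w : ℂ) * e‖ + ‖(alongSide e w : ℂ) * d‖ := by
        rw [h]
        exact norm_sub_le _ _
    _ = _ := by simp only [norm_mul, Complex.norm_real, Real.norm_eq_abs]

/-- Subsets of a compact set on which two independent linear heights are comonotone have uniformly
bounded length. -/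
theorem exists_hausdorffMeasure_le_of_comonotone {T : Set ℂ} (hT : IsCompact T) {d e : ℂ}
    (hde : ((starRingEnd ℂ) d * e).im ≠ 0) :
    ∃ c : ℝ, 0 ≤ c ∧ ∀ S ⊆ T,
      (∀ x ∈ S, ∀ y ∈ S, (alongSide d x ≤ alongSide d y ∧ alongSide e x ≤ alongSide e y) ∨
        (alongSide d y ≤ alongSide d x ∧ alongSide e y ≤ alongSide e x)) →
      μH[1] S ≤ ENNReal.ofReal c := by
  set D := |((starRingEnd ℂ) d * e).im| with hD
  have hDpos : 0 < D := abs_pos.2 hde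
  let u : ℂ → ℝ := fun z => alongSide d z + alongSide e z
  have hu : Continuous u := (continuous_alongSide d).add (continuous_alongSide e)
  obtain ⟨m, hm⟩ := (hT.image hu).bddBelow
  obtain ⟨M, hM⟩ := (hT.image hu).bddAbove
  set K : ℝ≥0 := ⟨(‖d‖ + ‖e‖) / D, by positivity⟩ with hK
  refine ⟨(K * (M - m).toNNReal : ℝ≥0), NNReal.coe_nonneg _, fun S hST hS => ?_⟩
  have hdist : ∀ x ∈ S, ∀ y ∈ S, dist x y ≤ K * dist (u x) (u y) := by
    intro x hx y hy
    have h := norm_mul_abs_im_le d e (x - y)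
    rw [alongSide_sub, alongSide_sub] at h
    have h1 : |alongSide d x - alongSide d y| ≤ |u x - u y| ∧
        |alongSide e x - alongSide e y| ≤ |u x - u y| := by
      simp only [u]
      rcases hS x hx y hy with ⟨h1, h2⟩ | ⟨h1, h2⟩
      · rw [abs_of_nonpos (by linarith), abs_of_nonpos (by linarith), abs_of_nonpos (by linarith)]
        constructor <;> linarith
      · rw [abs_of_nonneg (by linarith), abs_of_nonneg (by linarith), abs_of_nonneg (by linarith)]
        constructor <;> linarith
    rw [dist_eq_norm, Real.dist_eq]
    change _ ≤ (‖d‖ + ‖e‖) / D * _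
    rw [div_mul_eq_mul_div, le_div_iff₀ hDpos]
    calc ‖x - y‖ * D ≤ _ := h
      _ ≤ |u x - u y| * ‖e‖ + |u x - u y| * ‖d‖ :=
        add_le_add (mul_le_mul_of_nonneg_right h1.1 (norm_nonneg e))
          (mul_le_mul_of_nonneg_right h1.2 (norm_nonneg d))
      _ = _ := by ring
  have hinj : InjOn u S := fun x hx y hy hxy => by
    have := hdist x hx y hy
    rw [hxy, dist_self, mul_zero] at this
    exact dist_le_zero.1 this
  have hinv : LeftInvOn (Function.invFunOn u S) u S := hinj.leftInvOn_invFunOn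
  have hlip : LipschitzOnWith K (Function.invFunOn u S) (u '' S) := by
    refine LipschitzOnWith.of_dist_le_mul ?_
    rintro _ ⟨x, hx, rfl⟩ _ ⟨y, hy, rfl⟩
    rw [hinv hx, hinv hy]
    exact hdist x hx y hy
  have hsub : u '' S ⊆ Icc m M := by
    rintro _ ⟨x, hx, rfl⟩
    exact ⟨hm ⟨x, hST hx, rfl⟩, hM ⟨x, hST hx, rfl⟩⟩
  calc μH[1] S = μH[1] (Function.invFunOn u S '' (u '' S)) := by rw [hinv.image_image]
    _ ≤ (K : ℝ≥0∞) ^ (1 : ℝ) * μH[1] (u '' S) := hlip.hausdorffMeasure_image_le zero_le_one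
    _ ≤ K * μH[1] (Icc m M) := by
      rw [ENNReal.rpow_one]
      gcongr
    _ = ENNReal.ofReal (K * (M - m).toNNReal : ℝ≥0) := by
      rw [hausdorffMeasure_real, Real.volume_Icc, ENNReal.ofReal_coe_nnreal, ENNReal.coe_mul]
      rfl

theorem conj_mul_im_ne_zero_of_not_collinear {a b c : ℂ}
    (h : ¬ Collinear ℝ ({a, b, c} : Set ℂ)) :
    ((starRingEnd ℂ) (b - a) * (c - a)).im ≠ 0 := by
  contrapose! h
  rw [collinear_iff_of_mem (p₀ := a) (by simp)]
  by_cases hab : b - a = 0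
  · refine ⟨c - a, ?_⟩
    rintro p (rfl | rfl | rfl)
    · exact ⟨0, by simp⟩
    · exact ⟨0, by simpa using sub_eq_zero.1 hab⟩
    · exact ⟨1, by simp⟩
  · refine ⟨b - a, ?_⟩
    rintro p (rfl | rfl | rfl)
    · exact ⟨0, by simp⟩
    · exact ⟨1, by simp⟩
    · refine ⟨((starRingEnd ℂ) (b - a) * (p - a)).re / Complex.normSq (b - a), ?_⟩
      have hre : (((starRingEnd ℂ) (b - a) * (p - a)).re : ℂ) =
          (starRingEnd ℂ) (b - a) * (p - a) := Complex.ext (by simp) (by rw [h]; simp)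
      have hns : (Complex.normSq (b - a) : ℂ) = (starRingEnd ℂ) (b - a) * (b - a) :=
        Complex.normSq_eq_conj_mul_self
      have hconj : (starRingEnd ℂ) (b - a) ≠ 0 := (map_ne_zero _).2 hab
      rw [vadd_eq_add, Complex.real_smul, Complex.ofReal_div, hre, hns]
      field_simp
      ring

/-- The two long arcs containing a curve of a connection meet exactly in that curve, so it is
closed. -/
theorem isClosed_of_union_of_inter_eq_singleton {X : Type*} [TopologicalSpace X]
    {S S₂ S₃ : Set X} {p : X} (h₂ : IsClosed (S ∪ S₂)) (h₃ : IsClosed (S ∪ S₃))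
    (hp : S ∩ S₂ = {p}) (hp' : S₂ ∩ S₃ = {p}) : IsClosed S := by
  have hS : S = (S ∪ S₂) ∩ (S ∪ S₃) := by
    rw [← union_inter_distrib_left, hp', union_eq_left.2]
    exact singleton_subset_iff.2 (hp.ge rfl).1
  rw [hS]
  exact h₂.inter h₃

/-- Uniform length estimate: there is a constant `c > 0`, depending only on the triangle
`T` with vertices `α₁, α₂, α₃`, bounding the `ℋ¹`-length of the three curves
`Γᵢ ∪ Γⱼ` of every BV graph-type connection in `T`. -/
theorem stmt_16 (α₁ α₂ α₃ : ℂ) (hncol : ¬ Collinear ℝ ({α₁, α₂, α₃} : Set ℂ)) :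
    ∃ c > (0:ℝ), ∀ Γ : BVConn α₁ α₂ α₃,
      μH[1] (Γ.Γ₁ ∪ Γ.Γ₂) ≤ ENNReal.ofReal c ∧
      μH[1] (Γ.Γ₂ ∪ Γ.Γ₃) ≤ ENNReal.ofReal c ∧
      μH[1] (Γ.Γ₃ ∪ Γ.Γ₁) ≤ ENNReal.ofReal c := by
  have hne₁₂ : α₁ ≠ α₂ := by
    rintro rfl
    exact hncol (by simpa using collinear_pair ℝ α₁ α₃)
  have hne₂₃ : α₂ ≠ α₃ := by
    rintro rfl
    exact hncol (by simpa using collinear_pair ℝ α₁ α₂)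
  have hne₃₁ : α₃ ≠ α₁ := by
    rintro rfl
    exact hncol (by simpa [pair_comm] using collinear_pair ℝ α₃ α₂)
  have hT : IsCompact (convexHull ℝ ({α₁, α₂, α₃} : Set ℂ)) :=
    (Set.toFinite _).isCompact_convexHull ℝ
  obtain ⟨c₁, hc₁, H₁⟩ := exists_hausdorffMeasure_le_of_comonotone hT
    (conj_mul_im_ne_zero_of_not_collinear hncol)
  obtain ⟨c₂, hc₂, H₂⟩ := exists_hausdorffMeasure_le_of_comonotone hT
    (conj_mul_im_ne_zero_of_not_collinear (a := α₂) (b := α₃) (c := α₁)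
      (by convert hncol using 2; ext; simp; tauto))
  obtain ⟨c₃, hc₃, H₃⟩ := exists_hausdorffMeasure_le_of_comonotone hT
    (conj_mul_im_ne_zero_of_not_collinear (a := α₃) (b := α₁) (c := α₂)
      (by convert hncol using 2; ext; simp; tauto))
  refine ⟨c₁ + c₂ + c₃ + 1, by positivity, fun Γ => ?_⟩
  have hneg : ∀ a b : ℂ, (fun z => -alongSide (b - a) z) = alongSide (a - b) := fun a b => by
    ext z
    rw [← alongSide_neg, neg_sub]
  have h₁₂ := hasMonotoneCuts_side hne₁₂ Γ.bv₁₂ Γ.ext₁₂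
  have h₂₃ := hasMonotoneCuts_side hne₂₃ Γ.bv₂₃ Γ.ext₂₃
  have h₃₁ := hasMonotoneCuts_side hne₃₁ Γ.bv₃₁ Γ.ext₃₁
  rw [← Γ.graph₁₂] at h₁₂
  rw [← Γ.graph₂₃] at h₂₃
  rw [← Γ.graph₃₁] at h₃₁
  have h₂₁ := h₁₂.symm
  have h₃₂ := h₂₃.symm
  have h₁₃ := h₃₁.symm
  rw [hneg] at h₂₁ h₃₂ h₁₃
  have i₂₁ : Γ.Γ₂ ∩ Γ.Γ₁ = {Γ.p} := by rw [inter_comm, Γ.int₁₂]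
  have i₃₂ : Γ.Γ₃ ∩ Γ.Γ₂ = {Γ.p} := by rw [inter_comm, Γ.int₂₃]
  have i₁₃ : Γ.Γ₁ ∩ Γ.Γ₃ = {Γ.p} := by rw [inter_comm, Γ.int₃₁]
  have cl₁ : IsClosed Γ.Γ₁ := isClosed_of_union_of_inter_eq_singleton h₁₂.isClosed
    (by rw [union_comm]; exact h₃₁.isClosed) Γ.int₁₂ Γ.int₂₃
  have cl₂ : IsClosed Γ.Γ₂ := isClosed_of_union_of_inter_eq_singleton h₂₃.isClosed
    (by rw [union_comm]; exact h₁₂.isClosed) Γ.int₂₃ Γ.int₃₁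
  have cl₃ : IsClosed Γ.Γ₃ := isClosed_of_union_of_inter_eq_singleton h₃₁.isClosed
    (by rw [union_comm]; exact h₂₃.isClosed) Γ.int₃₁ Γ.int₁₂
  have b₁ : μH[1] Γ.Γ₁ ≤ ENNReal.ofReal c₁ := H₁ _ Γ.sub₁ fun x hx y hy =>
    h₁₂.comonotone h₁₃ cl₁ cl₂ cl₃ rfl (union_comm _ _) Γ.int₁₂ i₁₃ Γ.mem₂ Γ.mem₃ hx hy
  have b₂ : μH[1] Γ.Γ₂ ≤ ENNReal.ofReal c₂ := H₂ _ Γ.sub₂ fun x hx y hy =>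
    h₂₃.comonotone h₂₁ cl₂ cl₃ cl₁ rfl (union_comm _ _) Γ.int₂₃ i₂₁ Γ.mem₃ Γ.mem₁ hx hy
  have b₃ : μH[1] Γ.Γ₃ ≤ ENNReal.ofReal c₃ := H₃ _ Γ.sub₃ fun x hx y hy =>
    h₃₁.comonotone h₃₂ cl₃ cl₁ cl₂ rfl (union_comm _ _) Γ.int₃₁ i₃₂ Γ.mem₁ Γ.mem₂ hx hy
  have key : ∀ {S S' : Set ℂ} {r r' : ℝ}, 0 ≤ r → 0 ≤ r' → μH[1] S ≤ ENNReal.ofReal r →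
      μH[1] S' ≤ ENNReal.ofReal r' → r + r' ≤ c₁ + c₂ + c₃ + 1 →
      μH[1] (S ∪ S') ≤ ENNReal.ofReal (c₁ + c₂ + c₃ + 1) := by
    intro S S' r r' hr hr' hS hS' hle
    calc μH[1] (S ∪ S') ≤ μH[1] S + μH[1] S' := measure_union_le _ _
      _ ≤ ENNReal.ofReal r + ENNReal.ofReal r' := add_le_add hS hS'
      _ = ENNReal.ofReal (r + r') := (ENNReal.ofReal_add hr hr').symm
      _ ≤ _ := ENNReal.ofReal_le_ofReal hle
  exact ⟨key hc₁ hc₂ b₁ b₂ (by linarith), key hc₂ hc₃ b₂ b₃ (by linarith),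
    key hc₃ hc₁ b₃ b₁ (by linarith)⟩
end
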